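/- arXiv:2506.06875 — 6 statements merged into one kernel-verified Lean document; each statement's English description precedes it below -/
import Mathlib

section
/- Let N ≥ 1 be an integer, R > 0, and α, β ∈ (−∞, N) with α + β = N. Then there exists a constant C = C(N, R, α, β) > 0 such that for all x, y ∈ B_R(0) with x ≠ y, ∫_{B_R(0)} |x−z|^{−α} |y−z|^{−β} dz ≤ C (1 + |ln |x−y||). -/
open MeasureTheory Metric
open Set Module

/-- On `(0, ∞)`, the radial Jacobian times a truncated power is a truncated power. -/
lemma pow_mul_indicator_rpow_neg {n : ℕ} (hn : 1 ≤ n) {a b s : ℝ} (ha : 0 ≤ a) (t : ℝ) :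
    t ^ (n - 1) * (Ioc a b).indicator (fun t ↦ t ^ (-s)) t =
      (Ioc a b).indicator (fun t ↦ t ^ ((n : ℝ) - s - 1)) t := by
  by_cases ht : t ∈ Ioc a b
  · have ht0 : 0 < t := ha.trans_lt ht.1
    rw [indicator_of_mem ht, indicator_of_mem ht, ← Real.rpow_natCast, ← Real.rpow_add ht0,
      Nat.cast_sub hn]
    congr 1
    push_cast
    ring
  · simp [ht]

section Radial

variable {E : Type*} [NormedAddCommGroup E] [NormedSpace ℝ E] [FiniteDimensional ℝ E]
  [Nontrivial E] [MeasurableSpace E] [BorelSpace E] (μ : Measure E) [μ.IsAddHaarMeasure]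

/-- A power of the distance to `x`, truncated to an annulus, is integrable as soon as the
corresponding one-dimensional power is. -/
lemma integrable_indicator_Ioc_rpow_neg_norm_sub (x : E) {a b s : ℝ} (ha : 0 ≤ a) (hab : a ≤ b)
    (h : IntervalIntegrable (fun t ↦ t ^ ((finrank ℝ E : ℝ) - s - 1)) volume a b) :
    Integrable (fun z ↦ (Ioc a b).indicator (fun t ↦ t ^ (-s)) ‖x - z‖) μ := by
  refine Integrable.comp_sub_left (f := fun z ↦ (Ioc a b).indicator (fun t ↦ t ^ (-s)) ‖z‖) ?_ x
  rw [integrable_fun_norm_addHaar μ (f := (Ioc a b).indicator (fun t ↦ t ^ (-s)))]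
  simp only [smul_eq_mul, pow_mul_indicator_rpow_neg (finrank_pos (R := ℝ) (M := E)) ha]
  rw [intervalIntegrable_iff_integrableOn_Ioc_of_le hab] at h
  exact ((integrable_indicator_iff measurableSet_Ioc).2 h).integrableOn

/-- The integral of a power of the distance to `x` over an annulus, in polar coordinates. -/
lemma integral_indicator_Ioc_rpow_neg_norm_sub (x : E) {a b s : ℝ} (ha : 0 ≤ a) (hab : a ≤ b) :
    ∫ z, (Ioc a b).indicator (fun t ↦ t ^ (-s)) ‖x - z‖ ∂μ =
      finrank ℝ E * μ.real (ball 0 1) * ∫ t in a..b, t ^ ((finrank ℝ E : ℝ) - s - 1) := by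
  rw [integral_sub_left_eq_self (fun z ↦ (Ioc a b).indicator (fun t ↦ t ^ (-s)) ‖z‖) μ x,
    integral_fun_norm_addHaar μ ((Ioc a b).indicator (fun t ↦ t ^ (-s)))]
  simp only [smul_eq_mul, nsmul_eq_mul,
    pow_mul_indicator_rpow_neg (finrank_pos (R := ℝ) (M := E)) ha]
  rw [setIntegral_indicator measurableSet_Ioc,
    inter_eq_right.2 (Ioc_subset_Ioi_self.trans (Ioi_subset_Ioi ha)), intervalIntegral.integral_of_le hab, mul_assoc]

end Radial

lemma rpow_neg_mul_rpow_neg_le_add {p q α β : ℝ} (hp : 0 < p) (hq : 0 < q) (hα : 0 ≤ α)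
    (hβ : 0 ≤ β) : p ^ (-α) * q ^ (-β) ≤ p ^ (-(α + β)) + q ^ (-(α + β)) := by
  have hp' := Real.rpow_nonneg hp.le (-(α + β))
  have hq' := Real.rpow_nonneg hq.le (-(α + β))
  rcases le_total p q with h | h
  · calc p ^ (-α) * q ^ (-β) ≤ p ^ (-α) * p ^ (-β) := by
          gcongr ?_ * ?_
          exact Real.rpow_le_rpow_of_nonpos hp h (by linarith)
      _ = p ^ (-(α + β)) := by rw [← Real.rpow_add hp]; congr 1; ring
      _ ≤ _ := by linarith
  · calc p ^ (-α) * q ^ (-β) ≤ q ^ (-α) * q ^ (-β) := by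
          gcongr ?_ * ?_
          exact Real.rpow_le_rpow_of_nonpos hq h (by linarith)
      _ = q ^ (-(α + β)) := by rw [← Real.rpow_add hq]; congr 1; ring
      _ ≤ _ := by linarith

/-- If `p + q ≥ 2 r`, then `p ^ (-α) * q ^ (-β)` is controlled by its singular parts near `p = 0`
and `q = 0`, and by powers of exponent `-(α + β)` away from these points. -/
lemma rpow_neg_mul_rpow_neg_le_indicator {p q r M α β : ℝ} (hp : 0 ≤ p) (hq : 0 ≤ q) (hr : 0 < r)
    (hα : 0 < α) (hβ : 0 < β) (hpM : p ≤ M) (hqM : q ≤ M) (hpq : 2 * r ≤ p + q) :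
    p ^ (-α) * q ^ (-β) ≤
      r ^ (-β) * (Ioc 0 r).indicator (fun t ↦ t ^ (-α)) p +
      r ^ (-α) * (Ioc 0 r).indicator (fun t ↦ t ^ (-β)) q +
      ((Ioc r M).indicator (fun t ↦ t ^ (-(α + β))) p +
        (Ioc r M).indicator (fun t ↦ t ^ (-(α + β))) q) := by
  have hind : ∀ {a b s t : ℝ}, 0 ≤ t → 0 ≤ (Ioc a b).indicator (fun t ↦ t ^ (-s)) t :=
    fun ht ↦ indicator_apply_nonneg fun _ ↦ Real.rpow_nonneg ht _
  have h₁ := mul_nonneg (Real.rpow_nonneg hr.le (-β)) (hind (a := 0) (b := r) (s := α) hp)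
  have h₂ := mul_nonneg (Real.rpow_nonneg hr.le (-α)) (hind (a := 0) (b := r) (s := β) hq)
  have h₃ := hind (a := r) (b := M) (s := α + β) hp
  have h₄ := hind (a := r) (b := M) (s := α + β) hq
  rcases hp.eq_or_lt with rfl | hp
  · rw [Real.zero_rpow (by linarith), zero_mul]
    positivity
  rcases hq.eq_or_lt with rfl | hq
  · rw [Real.zero_rpow (x := -β) (by linarith), mul_zero]
    positivity
  rcases le_or_gt p r with hpr | hpr
  · have hle : p ^ (-α) * q ^ (-β) ≤ r ^ (-β) * p ^ (-α) := by
      rw [mul_comm]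
      gcongr ?_ * _
      exact Real.rpow_le_rpow_of_nonpos hr (by linarith) (by linarith)
    rw [indicator_of_mem (show p ∈ Ioc 0 r from ⟨hp, hpr⟩)]
    linarith
  rcases le_or_gt q r with hqr | hqr
  · have hle : p ^ (-α) * q ^ (-β) ≤ r ^ (-α) * q ^ (-β) := by
      gcongr ?_ * _
      exact Real.rpow_le_rpow_of_nonpos hr (by linarith) (by linarith)
    rw [indicator_of_mem (show q ∈ Ioc 0 r from ⟨hq, hqr⟩)]
    linarith
  · have hle := rpow_neg_mul_rpow_neg_le_add hp hq hα.le hβ.le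
    rw [indicator_of_mem (show p ∈ Ioc r M from ⟨hpr, hpM⟩),
      indicator_of_mem (show q ∈ Ioc r M from ⟨hqr, hqM⟩)]
    linarith

/-- Let `N ≥ 1`, `R > 0`, and `α, β < N` with `α + β = N`. Then there is a
constant `C = C(N, R, α, β) > 0` such that for all `x ≠ y` in the ball `B_R(0)`,
`∫_{B_R(0)} |x−z|^{−α} |y−z|^{−β} dz ≤ C (1 + |ln |x−y||)`. -/
theorem hypersingular_ball_estimate_eq (N : ℕ) (hN : 1 ≤ N) (R : ℝ) (hR : 0 < R)
    (α β : ℝ) (hα : α < N) (hβ : β < N) (hαβ : α + β = N) :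
    ∃ C > 0, ∀ x y : EuclideanSpace ℝ (Fin N),
      x ∈ ball (0 : EuclideanSpace ℝ (Fin N)) R →
      y ∈ ball (0 : EuclideanSpace ℝ (Fin N)) R → x ≠ y →
      (∫ z in ball (0 : EuclideanSpace ℝ (Fin N)) R,
          ‖x - z‖ ^ (-α) * ‖y - z‖ ^ (-β))
        ≤ C * (1 + |Real.log ‖x - y‖|) := by
  have : Nonempty (Fin N) := ⟨⟨0, hN⟩⟩
  have hα0 : 0 < α := by linarith
  have hβ0 : 0 < β := by linarith
  set K : ℝ := N * volume.real (ball (0 : EuclideanSpace ℝ (Fin N)) 1)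
  have hK0 : 0 ≤ K := by positivity
  refine ⟨1 + K / β + K / α + 2 * K * |Real.log (4 * R)| + 2 * K, by positivity,
    fun x y hx hy hxy ↦ ?_⟩
  set d := ‖x - y‖
  have hd0 : 0 < d := norm_pos_iff.2 (sub_ne_zero.2 hxy)
  have hr : 0 < d / 2 := by positivity
  rw [mem_ball_zero_iff] at hx hy
  have hdR : d ≤ 2 * R := (norm_sub_le x y).trans (by linarith)
  have hrR : d / 2 ≤ 2 * R := by linarith
  have near_int : ∀ (w : EuclideanSpace ℝ (Fin N)) (s : ℝ), s < N →
      Integrable (fun z ↦ (Ioc 0 (d / 2)).indicator (fun t ↦ t ^ (-s)) ‖w - z‖) := by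
    refine fun w s hs ↦ integrable_indicator_Ioc_rpow_neg_norm_sub _ w le_rfl hr.le ?_
    rw [finrank_euclideanSpace_fin]
    exact intervalIntegral.intervalIntegrable_rpow' (by linarith)
  have near_eq : ∀ (w : EuclideanSpace ℝ (Fin N)) (s : ℝ), s < N →
      ∫ z, (Ioc 0 (d / 2)).indicator (fun t ↦ t ^ (-s)) ‖w - z‖ =
        K * ((d / 2) ^ (N - s) / (N - s)) := by
    intro w s hs
    rw [integral_indicator_Ioc_rpow_neg_norm_sub _ w le_rfl hr.le, finrank_euclideanSpace_fin,
      integral_rpow (Or.inl (by linarith)), sub_add_cancel, Real.zero_rpow (by linarith), sub_zero]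
  have far_exp : ∀ t : ℝ, t ^ ((N : ℝ) - (α + β) - 1) = t⁻¹ := by
    intro t
    rw [hαβ, sub_self, zero_sub, Real.rpow_neg_one]
  have far_int : ∀ w : EuclideanSpace ℝ (Fin N),
      Integrable (fun z ↦ (Ioc (d / 2) (2 * R)).indicator (fun t ↦ t ^ (-(α + β))) ‖w - z‖) := by
    refine fun w ↦ integrable_indicator_Ioc_rpow_neg_norm_sub _ w hr.le hrR ?_
    simp only [finrank_euclideanSpace_fin, far_exp]
    exact intervalIntegrable_inv_iff.2
      (Or.inr (notMem_uIcc_of_lt hr (by positivity)))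
  have far_eq : ∀ w : EuclideanSpace ℝ (Fin N),
      ∫ z, (Ioc (d / 2) (2 * R)).indicator (fun t ↦ t ^ (-(α + β))) ‖w - z‖ =
        K * (Real.log (4 * R) - Real.log d) := by
    intro w
    rw [integral_indicator_Ioc_rpow_neg_norm_sub _ w hr.le hrR]
    simp only [finrank_euclideanSpace_fin, far_exp]
    rw [integral_inv_of_pos hr (by positivity), ← Real.log_div (by positivity) hd0.ne']
    congr 2
    field_simp
    norm_num
  have hi₁ := (near_int x α hα).const_mul ((d / 2) ^ (-β))
  have hi₂ := (near_int y β hβ).const_mul ((d / 2) ^ (-α))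
  have hi₃ := (far_int x).fun_add (far_int y)
  have cancel : ∀ s : ℝ, (d / 2) ^ (-s) * (d / 2) ^ s = 1 := fun s ↦ by
    rw [← Real.rpow_add hr, neg_add_cancel, Real.rpow_zero]
  calc ∫ z in ball (0 : EuclideanSpace ℝ (Fin N)) R, ‖x - z‖ ^ (-α) * ‖y - z‖ ^ (-β)
      ≤ ∫ z in ball (0 : EuclideanSpace ℝ (Fin N)) R,
        ((d / 2) ^ (-β) * (Ioc 0 (d / 2)).indicator (fun t ↦ t ^ (-α)) ‖x - z‖ +
          (d / 2) ^ (-α) * (Ioc 0 (d / 2)).indicator (fun t ↦ t ^ (-β)) ‖y - z‖ +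
          ((Ioc (d / 2) (2 * R)).indicator (fun t ↦ t ^ (-(α + β))) ‖x - z‖ +
            (Ioc (d / 2) (2 * R)).indicator (fun t ↦ t ^ (-(α + β))) ‖y - z‖)) := by
        refine integral_mono_of_nonneg (.of_forall fun z ↦ by positivity)
          ((hi₁.add hi₂).add hi₃).integrableOn ?_
        filter_upwards [ae_restrict_mem measurableSet_ball] with z hz
        rw [mem_ball_zero_iff] at hz
        refine rpow_neg_mul_rpow_neg_le_indicator (norm_nonneg _) (norm_nonneg _) hr hα0 hβ0
          ((norm_sub_le x z).trans (by linarith)) ((norm_sub_le y z).trans (by linarith)) ?_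
        have := norm_sub_le_norm_sub_add_norm_sub x z y
        rw [norm_sub_rev z y] at this
        linarith
    _ ≤ ∫ z,
        ((d / 2) ^ (-β) * (Ioc 0 (d / 2)).indicator (fun t ↦ t ^ (-α)) ‖x - z‖ +
          (d / 2) ^ (-α) * (Ioc 0 (d / 2)).indicator (fun t ↦ t ^ (-β)) ‖y - z‖ +
          ((Ioc (d / 2) (2 * R)).indicator (fun t ↦ t ^ (-(α + β))) ‖x - z‖ +
            (Ioc (d / 2) (2 * R)).indicator (fun t ↦ t ^ (-(α + β))) ‖y - z‖)) := by
        refine setIntegral_le_integral ((hi₁.add hi₂).add hi₃) (.of_forall fun z ↦ ?_)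
        have hind : ∀ (a b s : ℝ) (w : EuclideanSpace ℝ (Fin N)),
            0 ≤ (Ioc a b).indicator (fun t : ℝ ↦ t ^ (-s)) ‖w - z‖ :=
          fun _ _ _ _ ↦ indicator_apply_nonneg fun _ ↦ Real.rpow_nonneg (norm_nonneg _) _
        have h₁ := hind 0 (d / 2) α x
        have h₂ := hind 0 (d / 2) β y
        have h₃ := hind (d / 2) (2 * R) (α + β) x
        have h₄ := hind (d / 2) (2 * R) (α + β) y
        simp only [Pi.zero_apply]
        positivity
    _ = (d / 2) ^ (-β) * (K * ((d / 2) ^ (N - α) / (N - α))) +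
          (d / 2) ^ (-α) * (K * ((d / 2) ^ (N - β) / (N - β))) +
          (K * (Real.log (4 * R) - Real.log d) + K * (Real.log (4 * R) - Real.log d)) := by
        rw [integral_add (hi₁.fun_add hi₂) hi₃, integral_add hi₁ hi₂,
          integral_add (far_int x) (far_int y), integral_const_mul, integral_const_mul,
          near_eq x α hα, near_eq y β hβ, far_eq, far_eq]
    _ = K / β + K / α + 2 * K * (Real.log (4 * R) - Real.log d) := by
        rw [show (N : ℝ) - α = β by linarith, show (N : ℝ) - β = α by linarith]
        linear_combination (K / β) * cancel β + (K / α) * cancel α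
    _ ≤ K / β + K / α + 2 * K * (|Real.log (4 * R)| + |Real.log d|) := by
        gcongr
        linarith [le_abs_self (Real.log (4 * R)), neg_abs_le (Real.log d)]
    _ ≤ (1 + K / β + K / α + 2 * K * |Real.log (4 * R)| + 2 * K) * (1 + |Real.log d|) := by
        have h : 0 ≤ (1 + K / β + K / α + 2 * K * |Real.log (4 * R)|) * |Real.log d| := by
          positivity
        linarith
end

section
/- Let Ω ⊂ ℝ^N, N ≥ 2, be a bounded domain whose boundary ∂Ω is of class C², let 0 < λ < 1 and 0 < a < 1. Then there exists C = C(N, λ, a, Ω) > 0 such that for all x ∈ Ω, ∫_Ω |x−y|^{λ−N} δ(y)^{−a} dy ≤ C (1 + ω_{a,λ}(x)), where ω_{a,λ}(x) = 1 if λ > a, ω_{a,λ}(x) = |ln δ(x)| if λ = a, and ω_{a,λ}(x) = δ(x)^{−(a−λ)} if λ < a. -/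
open MeasureTheory Metric

/-- An open set `Ω` has boundary of class `C²` if near every boundary point it admits a
`C²` defining function with nonvanishing gradient on the boundary. -/
def HasC2Boundary {E : Type*} [NormedAddCommGroup E] [NormedSpace ℝ E] (Ω : Set E) : Prop :=
  ∀ x ∈ frontier Ω, ∃ U : Set E, IsOpen U ∧ x ∈ U ∧ ∃ ρ : E → ℝ,
    ContDiff ℝ 2 ρ ∧ Ω ∩ U = {y ∈ U | ρ y < 0} ∧
    frontier Ω ∩ U = {y ∈ U | ρ y = 0} ∧
    ∀ y ∈ frontier Ω ∩ U, fderiv ℝ ρ y ≠ 0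

lemma lintegral_Ioo_rpow_neg {a r : ℝ} (ha1 : a < 1) (hr : 0 ≤ r) :
    ∫⁻ s in Set.Ioo 0 r, ENNReal.ofReal (s ^ (-a)) = ENNReal.ofReal (r ^ (1 - a) / (1 - a)) := by
  have hint : IntervalIntegrable (fun s : ℝ => s ^ (-a)) volume 0 r :=
    intervalIntegral.intervalIntegrable_rpow' (by linarith)
  rw [← ofReal_integral_eq_lintegral_ofReal]
  · rw [← integral_Ioc_eq_integral_Ioo, ← intervalIntegral.integral_of_le hr,
      integral_rpow (Or.inl (by linarith)), Real.zero_rpow (by linarith)]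
    congr 1
    rw [sub_zero, neg_add_eq_sub]
  · exact ((intervalIntegrable_iff_integrableOn_Ioo_of_le hr).1 hint)
  · filter_upwards [ae_restrict_mem measurableSet_Ioo] with s hs
    exact Real.rpow_nonneg hs.1.le _

lemma lintegral_Ioo_abs_sub_rpow_neg_le {a r : ℝ} (ha0 : 0 < a) (ha1 : a < 1) (hr : 0 < r) (x₀ t₀ : ℝ) :
    ∫⁻ t in Set.Ioo (x₀ - r) (x₀ + r), ENNReal.ofReal (|t - t₀| ^ (-a)) ≤
      ENNReal.ofReal ((2 / (1 - a) + 2) * r ^ (1 - a)) := by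
  have ha1' : 0 < 1 - a := by linarith
  set h : ℝ → ENNReal := (Set.Ioo 0 r).indicator fun s => ENNReal.ofReal (s ^ (-a)) with hh
  have hhm : Measurable h := by
    refine Measurable.indicator ?_ measurableSet_Ioo
    fun_prop
  have hH : ∫⁻ s, h s = ENNReal.ofReal (r ^ (1 - a) / (1 - a)) := by
    rw [hh, lintegral_indicator measurableSet_Ioo, lintegral_Ioo_rpow_neg ha1 hr.le]
  have hpt : ∀ t, ENNReal.ofReal (|t - t₀| ^ (-a)) ≤
      h (t - t₀) + h (t₀ - t) + ENNReal.ofReal (r ^ (-a)) := by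
    intro t
    rcases le_or_gt r |t - t₀| with h1 | h1
    · refine le_add_left (ENNReal.ofReal_le_ofReal ?_)
      exact Real.rpow_le_rpow_of_nonpos hr h1 (by linarith)
    · rcases lt_trichotomy t t₀ with h2 | h2 | h2
      · refine le_add_right (le_add_left ?_)
        rw [abs_of_neg (by linarith), neg_sub] at h1 ⊢
        rw [hh, Set.indicator_of_mem (Set.mem_Ioo.2 ⟨by linarith, h1⟩)]
      · rw [h2, sub_self, abs_zero, Real.zero_rpow (by linarith)]
        simp
      · refine le_add_right (le_add_right ?_)
        rw [abs_of_pos (by linarith)] at h1 ⊢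
        rw [hh, Set.indicator_of_mem (Set.mem_Ioo.2 ⟨by linarith, h1⟩)]
  calc
    _ ≤ ∫⁻ t in Set.Ioo (x₀ - r) (x₀ + r),
        (h (t - t₀) + h (t₀ - t) + ENNReal.ofReal (r ^ (-a))) := lintegral_mono hpt
    _ = (∫⁻ t in Set.Ioo (x₀ - r) (x₀ + r), h (t - t₀)) +
        (∫⁻ t in Set.Ioo (x₀ - r) (x₀ + r), h (t₀ - t)) +
        ENNReal.ofReal (r ^ (-a)) * ENNReal.ofReal (2 * r) := by
      rw [lintegral_add_right _ measurable_const, lintegral_add_left (by fun_prop),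
        setLIntegral_const, Real.volume_Ioo, add_sub_sub_cancel, two_mul]
    _ ≤ (∫⁻ t, h (t - t₀)) + (∫⁻ t, h (t₀ - t)) +
        ENNReal.ofReal (r ^ (-a)) * ENNReal.ofReal (2 * r) := by
      gcongr <;> exact Measure.restrict_le_self
    _ = _ := by
      rw [lintegral_sub_right_eq_self, lintegral_sub_left_eq_self, hH,
        ← ENNReal.ofReal_add (by positivity) (by positivity),
        ← ENNReal.ofReal_mul (by positivity),
        ← ENNReal.ofReal_add (by positivity) (by positivity)]
      congr 1
      rw [show r ^ (-a) * (2 * r) = 2 * r ^ (1 - a) by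
        rw [sub_eq_neg_add, Real.rpow_add hr, Real.rpow_one]; ring]
      ring

lemma EuclideanSpace.lintegral_ball_le {n : ℕ} {F : EuclideanSpace ℝ (Fin (n + 1)) → ENNReal}
    (hF : Measurable F) (i : Fin (n + 1)) (x : EuclideanSpace ℝ (Fin (n + 1))) {r : ℝ}
    (hr : 0 < r) {M : ENNReal}
    (hM : ∀ z : Fin n → ℝ, ∫⁻ t in Set.Ioo (x i - r) (x i + r),
      F (WithLp.toLp 2 (i.insertNth t z : Fin (n + 1) → ℝ)) ≤ M) :
    ∫⁻ y in ball x r, F y ≤ M * ENNReal.ofReal ((2 * r) ^ n) := by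
  set e : ℝ × (Fin n → ℝ) → EuclideanSpace ℝ (Fin (n + 1)) :=
    fun q => WithLp.toLp 2 (i.insertNth q.1 q.2 : Fin (n + 1) → ℝ) with he
  have hmp : MeasurePreserving e volume volume :=
    (PiLp.volume_preserving_toLp (Fin (n + 1))).comp
      (volume_preserving_piFinSuccAbove (fun _ : Fin (n + 1) => ℝ) i).symm
  set I := Set.Ioo (x i - r) (x i + r) with hI
  set B : Set (Fin n → ℝ) :=
    Set.univ.pi fun j => Set.Ioo (x (i.succAbove j) - r) (x (i.succAbove j) + r) with hB
  have hBm : MeasurableSet B := MeasurableSet.univ_pi fun _ => measurableSet_Ioo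
  have hBv : volume B = ENNReal.ofReal ((2 * r) ^ n) := by
    rw [hB, Real.volume_pi_Ioo, ENNReal.ofReal_pow (by positivity)]
    simp only [add_sub_sub_cancel, Finset.prod_const, Finset.card_univ, Fintype.card_fin, two_mul]
  have hsub : ∀ y ∈ ball x r, ∀ j, y j ∈ Set.Ioo (x j - r) (x j + r) := by
    intro y hy j
    rw [← Real.ball_eq_Ioo, mem_ball, Real.dist_eq]
    refine lt_of_le_of_lt ?_ (mem_ball.1 hy)
    rw [dist_eq_norm]
    exact PiLp.norm_apply_le (y - x) j
  have hFm : Measurable ((ball x r).indicator F) := hF.indicator measurableSet_ball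
  rw [← lintegral_indicator measurableSet_ball, ← hmp.lintegral_comp hFm,
    Measure.volume_eq_prod,
    lintegral_prod_symm (fun q => (ball x r).indicator F (e q))
      (hFm.comp hmp.measurable).aemeasurable]
  calc
    _ ≤ ∫⁻ z, B.indicator (fun _ => M) z := by
      refine lintegral_mono fun z => ?_
      by_cases hz : z ∈ B
      · rw [Set.indicator_of_mem hz]
        refine le_trans ?_ (hM z)
        rw [← lintegral_indicator measurableSet_Ioo]
        refine lintegral_mono fun t => ?_
        by_cases ht : e (t, z) ∈ ball x r
        · have hti : t ∈ I := by simpa [he, hI] using hsub _ ht i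
          rw [Set.indicator_of_mem ht, Set.indicator_of_mem hti]
        · rw [Set.indicator_of_notMem ht]
          exact zero_le
      · rw [Set.indicator_of_notMem hz]
        refine le_of_eq (lintegral_eq_zero_of_ae_eq_zero (Filter.Eventually.of_forall fun t => ?_))
        refine Set.indicator_of_notMem (fun ht => hz fun j _ => ?_) _
        simpa [he] using hsub _ ht (i.succAbove j)
    _ = M * ENNReal.ofReal ((2 * r) ^ n) := by
      rw [lintegral_indicator hBm, setLIntegral_const, hBv]

lemma HasC2Boundary.exists_le_infDist_add_infDist {ι : Type*} [Fintype ι] [DecidableEq ι]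
    {Ω : Set (EuclideanSpace ℝ ι)} (hΩ : HasC2Boundary Ω) {p : EuclideanSpace ℝ ι}
    (hp : p ∈ frontier Ω) :
    ∃ i : ι, ∃ ε > 0, ∃ k > 0, ∀ y ∈ closedBall p ε, ∀ z ∈ closedBall p ε,
      (∀ j, j ≠ i → y j = z j) →
        k * |y i - z i| ≤ infDist y (frontier Ω) + infDist z (frontier Ω) := by
  obtain ⟨U, hUo, hpU, ρ, hρ, -, hfr, hgrad⟩ := hΩ p hp
  have hne := hgrad p ⟨hp, hpU⟩
  obtain ⟨i, hi⟩ : ∃ i, fderiv ℝ ρ p (EuclideanSpace.single i 1) ≠ 0 := by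
    by_contra! h
    apply hne
    ext y
    have hy : y = ∑ i, y i • EuclideanSpace.single i (1 : ℝ) := by
      simpa using ((EuclideanSpace.basisFun ι ℝ).sum_repr y).symm
    rw [hy, map_sum]
    simp [h]
  set A := fderiv ℝ ρ p with hA
  set v := A (EuclideanSpace.single i 1) with hv
  have hs : HasStrictFDerivAt ρ A p := (hρ.contDiffAt).hasStrictFDerivAt (by norm_num)
  obtain ⟨K, s, hs1, hK⟩ := hs.exists_lipschitzOnWith
  obtain ⟨t, ht, hAt⟩ := hs.approximates_deriv_on_nhds (c := ‖v‖₊ / 2)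
    (Or.inr (half_pos (nnnorm_pos.2 hi)))
  obtain ⟨η, hη, hball⟩ := Metric.mem_nhds_iff.1
    (Filter.inter_mem (Filter.inter_mem hs1 ht) (hUo.mem_nhds hpU))
  have hdist : ∀ y ∈ closedBall p (η / 3), |ρ y| ≤ (K + 1) * infDist y (frontier Ω) := by
    intro y hy
    obtain ⟨z, hz, hyz⟩ := isClosed_frontier.exists_infDist_eq_dist ⟨p, hp⟩ y
    have h1 : dist y p ≤ η / 3 := hy
    have h2 : dist y z ≤ dist y p := hyz ▸ infDist_le_dist_of_mem hp
    have hzb : z ∈ ball p η := by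
      rw [mem_ball]
      linarith [dist_triangle_left z p y]
    have hyb : y ∈ ball p η := by
      rw [mem_ball]
      linarith
    have hz0 : ρ z = 0 := by
      have : z ∈ frontier Ω ∩ U := ⟨hz, (hball hzb).2⟩
      rw [hfr] at this
      exact this.2
    have := hK.dist_le_mul y (hball hyb).1.1 z (hball hzb).1.1
    rw [Real.dist_eq, hz0, sub_zero] at this
    rw [hyz]
    linarith [dist_nonneg (x := y) (y := z)]
  refine ⟨i, η / 3, by positivity, |v| / 2 / (K + 1), by positivity, fun y hy z hz hyz => ?_⟩
  have hyb : y ∈ ball p η := closedBall_subset_ball (by linarith) hy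
  have hzb : z ∈ ball p η := closedBall_subset_ball (by linarith) hz
  have hyz' : y - z = (y i - z i) • EuclideanSpace.single i (1 : ℝ) := by
    ext j
    by_cases hj : j = i
    · subst hj; simp
    · simp [hj, hyz j hj]
  have h1 := hAt y (hball hyb).1.2 z (hball hzb).1.2
  rw [hyz', map_smul, norm_smul, ← hv, smul_eq_mul] at h1
  simp only [NNReal.coe_div, coe_nnnorm, Real.norm_eq_abs, NNReal.coe_ofNat,
    PiLp.norm_single, abs_one, mul_one] at h1
  have h2 := abs_sub_abs_le_abs_sub ((y i - z i) * v) (ρ y - ρ z)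
  rw [abs_mul, abs_sub_comm _ (ρ y - ρ z)] at h2
  have h3 := abs_sub (ρ y) (ρ z)
  rw [div_mul_eq_mul_div, div_le_iff₀ (by positivity)]
  linarith [hdist y hy, hdist z hz]

lemma HasC2Boundary.lintegral_closedBall_inter_ball_le {n : ℕ}
    {Ω : Set (EuclideanSpace ℝ (Fin (n + 1)))} (hΩ : HasC2Boundary Ω)
    {p : EuclideanSpace ℝ (Fin (n + 1))} (hp : p ∈ frontier Ω)
    {a : ℝ} (ha0 : 0 < a) (ha1 : a < 1) :
    ∃ ε > 0, ∃ C ≥ 0, ∀ x, ∀ r > 0,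
      ∫⁻ y in closedBall p ε ∩ ball x r, ENNReal.ofReal (infDist y (frontier Ω) ^ (-a)) ≤
        ENNReal.ofReal (C * r ^ (((n + 1 : ℕ) : ℝ) - a)) := by
  obtain ⟨i, ε, hε, k, hk, hδ⟩ := hΩ.exists_le_infDist_add_infDist hp
  have ha1' : 0 < 1 - a := by linarith
  refine ⟨ε, hε, (k / 2) ^ (-a) * (2 / (1 - a) + 2) * 2 ^ n, by positivity, fun x r hr => ?_⟩
  set w : EuclideanSpace ℝ (Fin (n + 1)) → ENNReal :=
    fun y => ENNReal.ofReal (infDist y (frontier Ω) ^ (-a)) with hw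
  have hwm : Measurable w :=
    ((continuous_infDist_pt _).measurable.pow_const _).ennreal_ofReal
  rw [← setLIntegral_indicator measurableSet_closedBall]
  refine (EuclideanSpace.lintegral_ball_le (hwm.indicator measurableSet_closedBall) i x hr
    (M := ENNReal.ofReal ((k / 2) ^ (-a)) *
      ENNReal.ofReal ((2 / (1 - a) + 2) * r ^ (1 - a))) fun z => ?_).trans_eq ?_
  · set e : ℝ → EuclideanSpace ℝ (Fin (n + 1)) :=
      fun t => WithLp.toLp 2 (i.insertNth t z : Fin (n + 1) → ℝ) with he
    have hec : Continuous e := by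
      refine (PiLp.continuous_toLp 2 _).comp ?_
      exact continuous_id.finInsertNth (A := fun _ => ℝ) i continuous_const
    have hei : ∀ t, e t i = t := fun t => by simp [he]
    have hej : ∀ s t j, j ≠ i → e s j = e t j := by
      intro s t j hj
      obtain ⟨j, rfl⟩ := Fin.exists_succAbove_eq hj
      simp [he]
    rcases (e ⁻¹' closedBall p ε).eq_empty_or_nonempty with hT | hT
    · have : ∀ t, (closedBall p ε).indicator w (e t) = 0 := fun t =>
        by
        refine Set.indicator_of_notMem (fun ht => ?_) _
        exact (hT ▸ ht : t ∈ (∅ : Set ℝ))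
      exact (lintegral_congr this).trans_le (by simp)
    · have hTc : IsCompact (e ⁻¹' closedBall p ε) := by
        refine (isCompact_closedBall (p i) ε).of_isClosed_subset
          (isClosed_closedBall.preimage hec) fun t ht => ?_
        rw [mem_closedBall, Real.dist_eq, ← hei t]
        refine le_trans ?_ (mem_closedBall.1 ht)
        rw [dist_eq_norm]
        exact PiLp.norm_apply_le (e t - p) i
      obtain ⟨t₀, ht₀, hmin⟩ := hTc.exists_isMinOn hT
        ((continuous_infDist_pt (frontier Ω)).comp hec).continuousOn
      calc
        _ ≤ ∫⁻ t in Set.Ioo (x i - r) (x i + r),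
            ENNReal.ofReal ((k / 2) ^ (-a)) * ENNReal.ofReal (|t - t₀| ^ (-a)) := by
          refine lintegral_mono_ae (ae_restrict_of_ae ?_)
          filter_upwards [Measure.ae_ne volume t₀] with t ht
          by_cases htb : e t ∈ closedBall p ε
          · rw [Set.indicator_of_mem htb, ← ENNReal.ofReal_mul (by positivity),
              ← Real.mul_rpow (by positivity) (abs_nonneg _)]
            refine ENNReal.ofReal_le_ofReal (Real.rpow_le_rpow_of_nonpos ?_ ?_ (by linarith))
            · have := abs_pos.2 (sub_ne_zero.2 ht)
              positivity
            · have h1 := hδ _ htb _ ht₀ (hej t t₀)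
              have h2 : infDist (e t₀) (frontier Ω) ≤ infDist (e t) (frontier Ω) := hmin htb
              rw [hei, hei] at h1
              linarith
          · rw [Set.indicator_of_notMem htb]
            exact zero_le
        _ ≤ _ := by
          rw [lintegral_const_mul _ (by fun_prop)]
          gcongr
          exact lintegral_Ioo_abs_sub_rpow_neg_le ha0 ha1 hr _ _
  · rw [← ENNReal.ofReal_mul (by positivity), ← ENNReal.ofReal_mul (by positivity)]
    congr 1
    rw [show ((n + 1 : ℕ) : ℝ) - a = (1 - a) + n by push_cast; ring, Real.rpow_add hr,
      Real.rpow_natCast, mul_pow]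
    ring

lemma lintegral_ball_inter_ball_infDist_rpow_neg_le {n : ℕ}
    {S : Set (EuclideanSpace ℝ (Fin (n + 1)))} {p : EuclideanSpace ℝ (Fin (n + 1))}
    (hp : 0 < infDist p S) {a : ℝ} (ha0 : 0 < a) (ha1 : a < 1) :
    ∃ C ≥ 0, ∀ x, ∀ r > 0,
      ∫⁻ y in ball p (infDist p S / 2) ∩ ball x r, ENNReal.ofReal (infDist y S ^ (-a)) ≤
        ENNReal.ofReal (C * r ^ (((n + 1 : ℕ) : ℝ) - a)) := by
  set d := infDist p S with hd
  set V₁ := (volume (ball (0 : EuclideanSpace ℝ (Fin (n + 1))) 1)).toReal with hV₁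
  set V₂ := (volume (ball p (d / 2))).toReal with hV₂
  have h₁ : volume (ball (0 : EuclideanSpace ℝ (Fin (n + 1))) 1) = ENNReal.ofReal V₁ :=
    (ENNReal.ofReal_toReal measure_ball_lt_top.ne).symm
  have h₂ : volume (ball p (d / 2)) = ENNReal.ofReal V₂ :=
    (ENNReal.ofReal_toReal measure_ball_lt_top.ne).symm
  have hV₁0 : 0 ≤ V₁ := ENNReal.toReal_nonneg
  have hV₂0 : 0 ≤ V₂ := ENNReal.toReal_nonneg
  refine ⟨(d / 2) ^ (-a) * (V₁ + V₂), by positivity, fun x r hr => ?_⟩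
  have hvol : volume (ball p (d / 2) ∩ ball x r) ≤
      ENNReal.ofReal ((V₁ + V₂) * r ^ (((n + 1 : ℕ) : ℝ) - a)) := by
    have hna : (0 : ℝ) ≤ ((n + 1 : ℕ) : ℝ) - a := by
      push_cast
      linarith [n.cast_nonneg (α := ℝ)]
    rcases le_total r 1 with h | h
    · refine (measure_mono Set.inter_subset_right).trans ?_
      rw [Measure.addHaar_ball _ _ hr.le, h₁, ← ENNReal.ofReal_mul (by positivity)]
      refine ENNReal.ofReal_le_ofReal ?_
      rw [finrank_euclideanSpace_fin, mul_comm, ← Real.rpow_natCast]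
      gcongr ?_ * ?_
      · linarith
      · exact Real.rpow_le_rpow_of_exponent_ge hr h (by linarith)
    · refine (measure_mono Set.inter_subset_left).trans ?_
      rw [h₂]
      refine ENNReal.ofReal_le_ofReal ?_
      have := Real.one_le_rpow h hna
      nlinarith
  calc
    _ ≤ ∫⁻ y in ball p (d / 2) ∩ ball x r, ENNReal.ofReal ((d / 2) ^ (-a)) := by
      refine setLIntegral_mono' (measurableSet_ball.inter measurableSet_ball) fun y hy => ?_
      refine ENNReal.ofReal_le_ofReal
        (Real.rpow_le_rpow_of_nonpos (by positivity) ?_ (by linarith))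
      have h1 := infDist_le_infDist_add_dist (s := S) (x := p) (y := y)
      have h2 := mem_ball'.1 hy.1
      linarith
    _ ≤ _ := by
      rw [setLIntegral_const, mul_assoc, ENNReal.ofReal_mul (by positivity)]
      gcongr

lemma HasC2Boundary.lintegral_inter_ball_le {n : ℕ}
    {Ω : Set (EuclideanSpace ℝ (Fin (n + 1)))} (hΩ : HasC2Boundary Ω)
    (hΩb : Bornology.IsBounded Ω) (hne : (frontier Ω).Nonempty)
    {a : ℝ} (ha0 : 0 < a) (ha1 : a < 1) :
    ∃ C ≥ 0, ∀ x, ∀ r > 0,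
      ∫⁻ y in Ω ∩ ball x r, ENNReal.ofReal (infDist y (frontier Ω) ^ (-a)) ≤
        ENNReal.ofReal (C * r ^ (((n + 1 : ℕ) : ℝ) - a)) := by
  have hmono : ∀ ⦃s t : Set (EuclideanSpace ℝ (Fin (n + 1)))⦄, s ⊆ t →
      (∃ C ≥ 0, ∀ x, ∀ r > 0,
        ∫⁻ y in t ∩ ball x r, ENNReal.ofReal (infDist y (frontier Ω) ^ (-a)) ≤
          ENNReal.ofReal (C * r ^ (((n + 1 : ℕ) : ℝ) - a))) →
      ∃ C ≥ 0, ∀ x, ∀ r > 0,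
        ∫⁻ y in s ∩ ball x r, ENNReal.ofReal (infDist y (frontier Ω) ^ (-a)) ≤
          ENNReal.ofReal (C * r ^ (((n + 1 : ℕ) : ℝ) - a)) := by
    rintro s t hst ⟨C, hC, h⟩
    exact ⟨C, hC, fun x r hr =>
      (lintegral_mono_set (Set.inter_subset_inter_left _ hst)).trans (h x r hr)⟩
  refine hmono subset_closure (hΩb.isCompact_closure.induction_on ⟨0, le_rfl, by simp⟩ hmono ?_ ?_)
  · rintro s t ⟨C, hC, h⟩ ⟨C', hC', h'⟩
    refine ⟨C + C', by positivity, fun x r hr => ?_⟩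
    rw [Set.union_inter_distrib_right, add_mul, ENNReal.ofReal_add (by positivity) (by positivity)]
    exact (lintegral_union_le _ _ _).trans (add_le_add (h x r hr) (h' x r hr))
  · intro p _
    by_cases hp : p ∈ frontier Ω
    · obtain ⟨ε, hε, h⟩ := hΩ.lintegral_closedBall_inter_ball_le hp ha0 ha1
      exact ⟨_, mem_nhdsWithin_of_mem_nhds (closedBall_mem_nhds p hε), h⟩
    · have hpos := (isClosed_frontier.notMem_iff_infDist_pos hne).1 hp
      exact ⟨_, mem_nhdsWithin_of_mem_nhds (ball_mem_nhds p (half_pos hpos)),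
        lintegral_ball_inter_ball_infDist_rpow_neg_le hpos ha0 ha1⟩

lemma lintegral_dist_rpow_le {E : Type*} [MetricSpace E] [MeasurableSpace E]
    [OpensMeasurableSpace E] [SecondCountableTopology E] (ν : Measure E) [SFinite ν] (x : E) {q : ℝ} (hq : q < 0) :
    ∫⁻ y, ENNReal.ofReal (dist x y ^ q) ∂ν ≤
      ENNReal.ofReal (-q) *
        ∫⁻ r in Set.Ioi (0 : ℝ), ENNReal.ofReal (r ^ (q - 1)) * ν (ball x r) := by
  have hpt : ∀ y, ENNReal.ofReal (dist x y ^ q) ≤ ENNReal.ofReal (-q) *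
      ∫⁻ r in Set.Ioi (0 : ℝ),
        (Set.Ioi (dist x y)).indicator (fun r => ENNReal.ofReal (r ^ (q - 1))) r := by
    intro y
    rcases (dist_nonneg (x := x) (y := y)).eq_or_lt with h | h
    · rw [← h, Real.zero_rpow hq.ne]
      simp
    · rw [setLIntegral_indicator measurableSet_Ioi,
        Set.inter_eq_left.2 (Set.Ioi_subset_Ioi h.le), ← ofReal_integral_eq_lintegral_ofReal
          (integrableOn_Ioi_rpow_of_lt (by linarith) h), integral_Ioi_rpow_of_lt (by linarith) h,
        ← ENNReal.ofReal_mul (by linarith), sub_add_cancel]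
      · refine ENNReal.ofReal_le_ofReal (le_of_eq ?_)
        field_simp [hq.ne]
      · filter_upwards [ae_restrict_mem measurableSet_Ioi] with r hr
        exact Real.rpow_nonneg (h.trans hr).le _
  have hset : MeasurableSet {z : E × ℝ | dist x z.1 < z.2} :=
    measurableSet_lt ((measurable_const.dist measurable_id).comp measurable_fst) measurable_snd
  refine (lintegral_mono hpt).trans ?_
  rw [lintegral_const_mul' _ _ ENNReal.ofReal_ne_top, lintegral_lintegral_swap]
  · gcongr with r
    refine (lintegral_mono (g := (ball x r).indicator fun _ => ENNReal.ofReal (r ^ (q - 1)))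
      fun y => ?_).trans_eq ?_
    · by_cases h : dist x y < r
      · rw [Set.indicator_of_mem (mem_ball'.2 h), Set.indicator_of_mem (Set.mem_Ioi.2 h)]
      · rw [Set.indicator_of_notMem (by simpa using h)]
        exact zero_le
    · rw [lintegral_indicator measurableSet_ball, setLIntegral_const]
  · have : Measurable fun z : E × ℝ => {z : E × ℝ | dist x z.1 < z.2}.indicator
      (fun z => ENNReal.ofReal (z.2 ^ (q - 1))) z := Measurable.indicator (by fun_prop) hset
    exact this.aemeasurable

lemma exists_rpow_sub_le_and_integral_rpow_le {lam a D : ℝ} (hD : 0 < D) :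
    ∃ K ≥ 0, ∀ d, 0 < d → d ≤ D →
      d ^ (lam - a) ≤ K * (1 + (if a < lam then 1
        else if lam = a then |Real.log d| else d ^ (-(a - lam)))) ∧
      ∫ r in (d / 2)..D, r ^ (lam - a - 1) ≤ K * (1 + (if a < lam then 1
        else if lam = a then |Real.log d| else d ^ (-(a - lam)))) := by
  have hint : ∀ d, 0 < d → lam ≠ a → ∫ r in (d / 2)..D, r ^ (lam - a - 1) =
      (D ^ (lam - a) - (d / 2) ^ (lam - a)) / (lam - a) := by
    intro d hd hne
    rw [integral_rpow, sub_add_cancel]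
    refine Or.inr ⟨fun h => hne (by linarith), fun h => ?_⟩
    rw [Set.mem_uIcc] at h
    rcases h with h | h <;> linarith
  rcases lt_trichotomy a lam with h | h | h
  · have h' : 0 < lam - a := sub_pos.2 h
    refine ⟨D ^ (lam - a) + D ^ (lam - a) / (lam - a), by positivity, fun d hd hdD => ?_⟩
    rw [if_pos h, hint d hd h.ne']
    have h0 : 0 ≤ D ^ (lam - a) / (lam - a) := by positivity
    have h1 : d ^ (lam - a) ≤ D ^ (lam - a) := Real.rpow_le_rpow hd.le hdD h'.le
    have h2 : (0 : ℝ) < d ^ (lam - a) := by positivity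
    have h3 : (D ^ (lam - a) - (d / 2) ^ (lam - a)) / (lam - a) ≤ D ^ (lam - a) / (lam - a) := by
      gcongr
      have : 0 ≤ (d / 2) ^ (lam - a) := by positivity
      linarith
    constructor <;> linarith
  · refine ⟨1 + |Real.log (2 * D)|, by positivity, fun d hd hdD => ?_⟩
    rw [if_neg h.not_lt, if_pos h.symm, h, sub_self, zero_sub, Real.rpow_zero]
    simp only [Real.rpow_neg_one]
    rw [integral_inv_of_pos (by positivity) hD, show D / (d / 2) = 2 * D / d by field_simp,
      Real.log_div (by positivity) hd.ne']
    have h1 := le_abs_self (Real.log (2 * D))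
    have h2 := neg_le_abs (Real.log d)
    have h3 := abs_nonneg (Real.log (2 * D))
    have h4 := abs_nonneg (Real.log d)
    constructor <;> nlinarith
  · have h' : 0 < a - lam := sub_pos.2 h
    refine ⟨1 + 2 ^ (a - lam) / (a - lam), by positivity, fun d hd hdD => ?_⟩
    rw [if_neg h.not_gt, if_neg h.ne, hint d hd h.ne, neg_sub]
    have h1 : (0 : ℝ) < d ^ (lam - a) := by positivity
    have h2 : (0 : ℝ) ≤ 2 ^ (a - lam) / (a - lam) := by positivity
    have h3 : (D ^ (lam - a) - (d / 2) ^ (lam - a)) / (lam - a) ≤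
        2 ^ (a - lam) / (a - lam) * d ^ (lam - a) := by
      rw [← neg_div_neg_eq, neg_sub, neg_sub, Real.div_rpow hd.le (by norm_num),
        ← neg_sub a lam, Real.rpow_neg (by norm_num : (0 : ℝ) ≤ 2), div_inv_eq_mul,
        div_mul_eq_mul_div, mul_comm]
      gcongr
      have : 0 ≤ D ^ (-(a - lam)) := by positivity
      linarith
    constructor <;> nlinarith

lemma setLIntegral_ofReal_mul_le {s : Set ℝ} (hs : MeasurableSet s) {f g : ℝ → ℝ}
    {m : ℝ → ENNReal} (hf : ∀ r ∈ s, 0 ≤ f r) (hg : IntegrableOn g s)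
    (hg0 : ∀ r ∈ s, 0 ≤ g r) {c : ℝ → ℝ} (hm : ∀ r ∈ s, m r ≤ ENNReal.ofReal (c r))
    (hfc : ∀ r ∈ s, f r * c r = g r) :
    ∫⁻ r in s, ENNReal.ofReal (f r) * m r ≤ ENNReal.ofReal (∫ r in s, g r) := by
  rw [ofReal_integral_eq_lintegral_ofReal hg]
  · refine setLIntegral_mono' hs fun r hr => ?_
    rw [← hfc r hr, ENNReal.ofReal_mul (hf r hr)]
    gcongr
    exact hm r hr
  · filter_upwards [ae_restrict_mem hs] with r hr using hg0 r hr

/-- If the mass of balls centred at `x` grows at most like `r ^ (N - a)`, and like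
`d ^ (-a) * r ^ N` for `r ≤ d / 2`, then the Riesz potential of `ν` at `x` is controlled by an
explicit one-dimensional integral. -/
lemma lintegral_dist_rpow_le_of_measure_ball_le {E : Type*} [MetricSpace E] [MeasurableSpace E]
    [OpensMeasurableSpace E] [SecondCountableTopology E] (ν : Measure E) [SFinite ν] (x : E)
    {N lam a d D C₁ C₂ C₃ : ℝ} (hlam0 : 0 < lam) (hlam : lam < N) (hd : 0 < d) (hdD : d ≤ D)
    (hC₁ : 0 ≤ C₁) (hC₂ : 0 ≤ C₂) (hC₃ : 0 ≤ C₃)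
    (h₁ : ∀ r, 0 < r → r ≤ d / 2 → ν (ball x r) ≤ ENNReal.ofReal (C₁ * d ^ (-a) * r ^ N))
    (h₂ : ∀ r > 0, ν (ball x r) ≤ ENNReal.ofReal (C₂ * r ^ (N - a)))
    (h₃ : ∀ r, ν (ball x r) ≤ ENNReal.ofReal C₃) :
    ∫⁻ y, ENNReal.ofReal (dist x y ^ (lam - N)) ∂ν ≤
      ENNReal.ofReal ((N - lam) * (C₁ / lam * d ^ (lam - a) +
        C₂ * (∫ r in (d / 2)..D, r ^ (lam - a - 1)) + C₃ * D ^ (lam - N) / (N - lam))) := by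
  have hD : 0 < D := hd.trans_le hdD
  have hN : 0 < N - lam := sub_pos.2 hlam
  set q := lam - N with hq
  have hq0 : q < 0 := by linarith
  have hJ : 0 ≤ ∫ r in (d / 2)..D, r ^ (lam - a - 1) :=
    intervalIntegral.integral_nonneg (by linarith) fun r hr =>
      Real.rpow_nonneg ((half_pos hd).le.trans hr.1) _
  refine (lintegral_dist_rpow_le ν x hq0).trans ?_
  rw [show -q = N - lam by rw [hq]; ring, ENNReal.ofReal_mul hN.le]
  gcongr
  rw [ENNReal.ofReal_add (by positivity) (by positivity),
    ENNReal.ofReal_add (by positivity) (by positivity)]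
  have hsplit : Set.Ioi (0 : ℝ) ⊆ (Set.Ioc 0 (d / 2) ∪ Set.Ioc (d / 2) D) ∪ Set.Ioi D := by
    rw [Set.Ioc_union_Ioc_eq_Ioc (by positivity) (by linarith), Set.Ioc_union_Ioi_eq_Ioi hD.le]
  refine (lintegral_mono_set hsplit).trans ((lintegral_union_le _ _ _).trans
    (add_le_add ((lintegral_union_le _ _ _).trans (add_le_add ?_ ?_)) ?_))
  · have hint : IntervalIntegrable (fun r : ℝ => r ^ (lam - 1)) volume 0 (d / 2) :=
      intervalIntegral.intervalIntegrable_rpow' (by linarith)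
    refine (setLIntegral_ofReal_mul_le (g := fun r => C₁ * d ^ (-a) * r ^ (lam - 1))
      measurableSet_Ioc (fun r hr => Real.rpow_nonneg hr.1.le _)
      (((intervalIntegrable_iff_integrableOn_Ioc_of_le (by positivity)).1 hint).const_mul _)
      (fun r hr => ?_) (fun r hr => h₁ r hr.1 hr.2) fun r hr => ?_).trans ?_
    · have := hr.1
      positivity
    · rw [mul_left_comm, ← Real.rpow_add hr.1]
      congr 2
      rw [hq]
      ring
    · refine ENNReal.ofReal_le_ofReal ?_
      rw [integral_const_mul, ← intervalIntegral.integral_of_le (by positivity),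
        integral_rpow (Or.inl (by linarith)), sub_add_cancel, Real.zero_rpow hlam0.ne', sub_zero,
        sub_eq_neg_add lam a, Real.rpow_add hd]
      have : (d / 2) ^ lam ≤ d ^ lam := Real.rpow_le_rpow (by positivity) (by linarith) hlam0.le
      calc
        _ ≤ C₁ * d ^ (-a) * (d ^ lam / lam) := by gcongr
        _ = _ := by ring
  · have hint : IntervalIntegrable (fun r : ℝ => r ^ (lam - a - 1)) volume (d / 2) D := by
      refine intervalIntegral.intervalIntegrable_rpow (Or.inr fun h => ?_)
      rw [Set.mem_uIcc] at h
      rcases h with h | h <;> linarith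
    rw [← intervalIntegral.integral_const_mul, intervalIntegral.integral_of_le (by linarith)]
    refine setLIntegral_ofReal_mul_le (g := fun r => C₂ * r ^ (lam - a - 1))
      measurableSet_Ioc (fun r hr => ?_)
      (((intervalIntegrable_iff_integrableOn_Ioc_of_le (by linarith)).1 hint).const_mul _)
      (fun r hr => ?_) (fun r hr => h₂ r ((half_pos hd).trans hr.1)) fun r hr => ?_
    · exact Real.rpow_nonneg ((half_pos hd).trans hr.1).le _
    · have := (half_pos hd).trans hr.1
      positivity
    · rw [mul_left_comm, ← Real.rpow_add ((half_pos hd).trans hr.1)]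
      congr 2
      rw [hq]
      ring
  · refine (setLIntegral_ofReal_mul_le (g := fun r => C₃ * r ^ (q - 1))
      measurableSet_Ioi (fun r hr => Real.rpow_nonneg (hD.trans hr).le _)
      ((integrableOn_Ioi_rpow_of_lt (by linarith) hD).const_mul _)
      (fun r hr => mul_nonneg hC₃ (Real.rpow_nonneg (hD.trans hr).le _))
      (fun r _ => h₃ r) fun r _ => mul_comm _ _).trans_eq ?_
    congr 1
    rw [integral_const_mul, integral_Ioi_rpow_of_lt (by linarith) hD, sub_add_cancel,
      show N - lam = -q by rw [hq]; ring, neg_div, div_neg, mul_div_assoc]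
    ring

/-- Let `Ω ⊂ ℝ^N`, `N ≥ 2`, be a bounded domain with `C²` boundary,
`0 < λ < 1`, `0 < a < 1`. There is `C = C(N, λ, a, Ω) > 0` such that for all `x ∈ Ω`,
`∫_Ω |x−y|^{λ−N} δ(y)^{−a} dy ≤ C (1 + ω_{a,λ}(x))`, where `ω_{a,λ}(x) = 1` if `λ > a`,
`= |ln δ(x)|` if `λ = a`, and `= δ(x)^{−(a−λ)}` if `λ < a`; here `δ(x) = dist(x, ∂Ω)`. -/
theorem integral_dist_boundary_estimate (N : ℕ) (hN : 2 ≤ N)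
    (Ω : Set (EuclideanSpace ℝ (Fin N))) (hΩo : IsOpen Ω)
    (hΩb : Bornology.IsBounded Ω) (hΩconn : IsConnected Ω) (hC2 : HasC2Boundary Ω)
    (lam a : ℝ) (hlam0 : 0 < lam) (hlam1 : lam < 1) (ha0 : 0 < a) (ha1 : a < 1) :
    ∃ C > 0, ∀ x ∈ Ω,
      (∫ y in Ω, ‖x - y‖ ^ (lam - N) * (infDist y (frontier Ω)) ^ (-a))
        ≤ C * (1 +
            (if a < lam then 1
             else if lam = a then |Real.log (infDist x (frontier Ω))|
             else (infDist x (frontier Ω)) ^ (-(a - lam)))) := by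
  obtain ⟨n, rfl⟩ : ∃ n, N = n + 1 := ⟨N - 1, by omega⟩
  rcases (frontier Ω).eq_empty_or_nonempty with hne | hne
  · refine ⟨1, one_pos, fun x _ => ?_⟩
    have h0 : (0 : ℝ) ^ (-a) = 0 := Real.zero_rpow (by linarith)
    simp only [hne, infDist_empty, h0, mul_zero, integral_zero, one_mul]
    split_ifs <;> positivity
  have hN : lam < ((n + 1 : ℕ) : ℝ) := by
    push_cast
    linarith [n.cast_nonneg (α := ℝ)]
  obtain ⟨C, hC, hball⟩ := hC2.lintegral_inter_ball_le hΩb hne ha0 ha1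
  set D := diam (closure Ω) + 1 with hDdef
  have hD : 0 < D := by positivity
  have hdiam : ∀ x ∈ closure Ω, ∀ y ∈ closure Ω, dist x y < D := fun x hx y hy =>
    (dist_le_diam_of_mem hΩb.closure hx hy).trans_lt (lt_add_one _)
  obtain ⟨K, hK, hKb⟩ := exists_rpow_sub_le_and_integral_rpow_le (lam := lam) (a := a) hD
  set V := (volume (ball (0 : EuclideanSpace ℝ (Fin (n + 1))) 1)).toReal with hV
  have hV0 : 0 ≤ V := ENNReal.toReal_nonneg
  have hVeq : volume (ball (0 : EuclideanSpace ℝ (Fin (n + 1))) 1) = ENNReal.ofReal V :=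
    (ENNReal.ofReal_toReal measure_ball_lt_top.ne).symm
  set w : EuclideanSpace ℝ (Fin (n + 1)) → ENNReal :=
    fun y => ENNReal.ofReal (infDist y (frontier Ω) ^ (-a)) with hw
  have hwm : Measurable w :=
    ((continuous_infDist_pt _).measurable.pow_const _).ennreal_ofReal
  set ν := (volume.restrict Ω).withDensity w with hν
  have hνball : ∀ x r, ν (ball x r) = ∫⁻ y in Ω ∩ ball x r, w y := fun x r => by
    rw [hν, withDensity_apply _ measurableSet_ball, Measure.restrict_restrict measurableSet_ball,
      Set.inter_comm]
  set C₁ := 2 ^ a * V with hC₁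
  set C₃ := C * D ^ (((n + 1 : ℕ) : ℝ) - a) with hC₃
  have hNl : 0 < ((n + 1 : ℕ) : ℝ) - lam := sub_pos.2 hN
  have hC₁0 : 0 ≤ C₁ := by positivity
  have hC₃0 : 0 ≤ C₃ := by positivity
  set A := (((n + 1 : ℕ) : ℝ) - lam) * (C₁ / lam * K + C * K +
    C₃ * D ^ (lam - ((n + 1 : ℕ) : ℝ)) / (((n + 1 : ℕ) : ℝ) - lam)) with hA
  have hA0 : 0 ≤ A := by positivity
  refine ⟨A + 1, by positivity, fun x hx => ?_⟩
  set d := infDist x (frontier Ω) with hd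
  have hd0 : 0 < d := (isClosed_frontier.notMem_iff_infDist_pos hne).1 fun h =>
    (hΩo.frontier_eq ▸ h).2 hx
  have hdD : d ≤ D := by
    obtain ⟨p, hp⟩ := hne
    exact (infDist_le_dist_of_mem hp).trans
      (hdiam x (subset_closure hx) p (frontier_subset_closure hp)).le
  obtain ⟨hK₁, hK₂⟩ := hKb d hd0 hdD
  have hW0 : 0 ≤ if a < lam then 1 else if lam = a then |Real.log d| else d ^ (-(a - lam)) := by
    split_ifs <;> positivity
  set W := if a < lam then 1 else if lam = a then |Real.log d| else d ^ (-(a - lam)) with hW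
  have hpot := lintegral_dist_rpow_le_of_measure_ball_le ν x (N := ((n + 1 : ℕ) : ℝ)) (a := a)
    hlam0 hN hd0 hdD hC₁0 hC hC₃0 ?_ (fun r hr => (hνball x r).trans_le (hball x r hr)) ?_
  · have hmeas : Measurable fun y => ‖x - y‖ ^ (lam - ((n + 1 : ℕ) : ℝ)) *
        infDist y (frontier Ω) ^ (-a) :=
      ((measurable_const.sub measurable_id).norm.pow_const _).mul
        ((continuous_infDist_pt _).measurable.pow_const _)
    rw [integral_eq_lintegral_of_nonneg_ae (Filter.Eventually.of_forall fun y =>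
      mul_nonneg (Real.rpow_nonneg (norm_nonneg _) _) (Real.rpow_nonneg infDist_nonneg _))
      hmeas.aestronglyMeasurable]
    refine ENNReal.toReal_le_of_le_ofReal (by positivity) ?_
    refine Eq.trans_le ?_ (hpot.trans (ENNReal.ofReal_le_ofReal ?_))
    · have hdm : Measurable fun y => ENNReal.ofReal (dist x y ^ (lam - ((n + 1 : ℕ) : ℝ))) :=
        ((measurable_const.dist measurable_id).pow_const _).ennreal_ofReal
      rw [hν, lintegral_withDensity_eq_lintegral_mul _ hwm hdm]
      refine lintegral_congr fun y => ?_
      rw [Pi.mul_apply, hw, ← ENNReal.ofReal_mul (Real.rpow_nonneg infDist_nonneg _), dist_eq_norm,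
        mul_comm]
    · calc
        _ ≤ (((n + 1 : ℕ) : ℝ) - lam) * (C₁ / lam * (K * (1 + W)) + C * (K * (1 + W)) +
            C₃ * D ^ (lam - ((n + 1 : ℕ) : ℝ)) / (((n + 1 : ℕ) : ℝ) - lam) * (1 + W)) := by
          gcongr
          exact le_mul_of_one_le_right (by positivity) (by linarith)
        _ = A * (1 + W) := by rw [hA]; ring
        _ ≤ (A + 1) * (1 + W) := by gcongr; linarith
  · intro r hr hrd
    rw [hνball]
    calc
      _ ≤ ∫⁻ y in Ω ∩ ball x r, ENNReal.ofReal ((d / 2) ^ (-a)) := by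
        refine setLIntegral_mono' (hΩo.measurableSet.inter measurableSet_ball) fun y hy => ?_
        refine ENNReal.ofReal_le_ofReal
          (Real.rpow_le_rpow_of_nonpos (by positivity) ?_ (by linarith))
        have h1 := infDist_le_infDist_add_dist (s := frontier Ω) (x := x) (y := y)
        have h2 := mem_ball'.1 hy.2
        linarith
      _ ≤ ENNReal.ofReal ((d / 2) ^ (-a)) * volume (ball x r) := by
        rw [setLIntegral_const]
        gcongr
        exact Set.inter_subset_right
      _ = _ := by
        rw [Measure.addHaar_ball _ _ hr.le, hVeq, ← ENNReal.ofReal_mul (by positivity),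
          ← ENNReal.ofReal_mul (by positivity), finrank_euclideanSpace_fin, Real.rpow_natCast,
          Real.div_rpow hd0.le (by norm_num), Real.rpow_neg (by norm_num : (0 : ℝ) ≤ 2)]
        congr 1
        rw [hC₁, div_inv_eq_mul]
        ring
  · intro r
    rw [hνball]
    refine le_trans (lintegral_mono_set fun y hy => Set.mem_inter hy.1 ?_) (hball x D hD)
    exact mem_ball'.2 (hdiam x (subset_closure hx) y (subset_closure hy.1))
end

section
/- For every α ≥ 1 there exists a constant C > 0 such that for all real numbers a, b ≥ 0, (a − b)(a^α − b^α) ≥ C |a^{(α+1)/2} − b^{(α+1)/2}|². -/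
/-- Bernoulli's inequality in the form of a mean value estimate. -/
lemma rpow_sub_rpow_le_mul_sub {p a b : ℝ} (hp : 1 ≤ p) (ha : 0 < a) (hb : 0 ≤ b) :
    a ^ p - b ^ p ≤ p * a ^ (p - 1) * (a - b) := by
  have hs : -1 ≤ b / a - 1 := by
    have : 0 ≤ b / a := by positivity
    linarith
  have h := one_add_mul_self_le_rpow_one_add hs hp
  rw [add_sub_cancel, Real.div_rpow hb ha.le, le_div_iff₀ (Real.rpow_pos_of_pos ha p)] at h
  have hap : a ^ p = a ^ (p - 1) * a := by
    rw [← Real.rpow_add_one ha.ne', sub_add_cancel]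
  have hmul : (1 + p * (b / a - 1)) * a ^ p = a ^ p + p * a ^ (p - 1) * (b - a) := by
    rw [hap]
    field_simp
  linarith

lemma sq_rpow_sub_rpow_le_of_le {p a b : ℝ} (hp : 1 ≤ p) (hb : 0 ≤ b) (hab : b ≤ a) :
    p⁻¹ * (a ^ p - b ^ p) ^ 2 ≤ (a - b) * (a ^ (2 * p - 1) - b ^ (2 * p - 1)) := by
  have hp0 : 0 < p := by linarith
  have ha := hb.trans hab
  rcases ha.eq_or_lt with rfl | ha0
  · obtain rfl : b = 0 := le_antisymm hab hb
    simp
  have hsplit : ∀ x : ℝ, 0 ≤ x → x ^ (2 * p - 1) = x ^ (p - 1) * x ^ p := fun x hx => by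
    rw [← Real.rpow_add_of_nonneg hx (by linarith) hp0.le]
    ring_nf
  have hX : 0 ≤ a ^ p - b ^ p := sub_nonneg.2 (Real.rpow_le_rpow hb hab hp0.le)
  have hY : a ^ (p - 1) * (a ^ p - b ^ p) ≤ a ^ (2 * p - 1) - b ^ (2 * p - 1) := by
    rw [hsplit a ha, hsplit b hb, mul_sub]
    have : b ^ (p - 1) ≤ a ^ (p - 1) := Real.rpow_le_rpow hb hab (by linarith)
    gcongr
  calc p⁻¹ * (a ^ p - b ^ p) ^ 2
      = p⁻¹ * ((a ^ p - b ^ p) * (a ^ p - b ^ p)) := by rw [sq]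
    _ ≤ p⁻¹ * (p * a ^ (p - 1) * (a - b) * (a ^ p - b ^ p)) := by
        gcongr
        exact rpow_sub_rpow_le_mul_sub hp ha0 hb
    _ = (a - b) * (a ^ (p - 1) * (a ^ p - b ^ p)) := by field_simp
    _ ≤ _ := mul_le_mul_of_nonneg_left hY (sub_nonneg.2 hab)

/-- For every `α ≥ 1` there is `C > 0` such that for all reals `a, b ≥ 0`,
`(a − b)(a^α − b^α) ≥ C |a^{(α+1)/2} − b^{(α+1)/2}|²`. -/
theorem algebraic_inequality_first (α : ℝ) (hα : 1 ≤ α) :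
    ∃ C > 0, ∀ a b : ℝ, 0 ≤ a → 0 ≤ b →
      (a - b) * (a ^ α - b ^ α) ≥ C * |a ^ ((α + 1) / 2) - b ^ ((α + 1) / 2)| ^ 2 := by
  have hp : 1 ≤ (α + 1) / 2 := by linarith
  have hα' : 2 * ((α + 1) / 2) - 1 = α := by ring
  refine ⟨((α + 1) / 2)⁻¹, by positivity, fun a b ha hb => ?_⟩
  rw [sq_abs]
  rcases le_total b a with hab | hab
  · simpa only [hα'] using sq_rpow_sub_rpow_le_of_le hp hb hab
  · have h := sq_rpow_sub_rpow_le_of_le hp ha hab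
    rw [hα'] at h
    linarith
end

section
/- For every α ≥ 1 there exists a constant C > 0 such that for all real numbers a, b ≥ 0, (a − b)² (a + b)^{α−1} ≤ C (a^{(α+1)/2} − b^{(α+1)/2})². -/
/-- For `p ≥ 1` and `0 ≤ b ≤ a`, `(a - b) a^{p-1} ≤ a^p - b^p`. -/
theorem sub_mul_rpow_sub_one_le {p a b : ℝ} (hp : 1 ≤ p) (hb : 0 ≤ b) (hab : b ≤ a) :
    (a - b) * a ^ (p - 1) ≤ a ^ p - b ^ p := by
  have split {x : ℝ} (hx : 0 ≤ x) : x ^ p = x * x ^ (p - 1) := by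
    rw [← Real.rpow_one_add' hx (by linarith), add_sub_cancel]
  rw [split (hb.trans hab), split hb, sub_mul]
  gcongr

theorem sq_sub_mul_rpow_add_le_of_le {α a b : ℝ} (hα : 1 ≤ α) (hb : 0 ≤ b) (hab : b ≤ a) :
    (a - b) ^ 2 * (a + b) ^ (α - 1) ≤
      2 ^ (α - 1) * (a ^ ((α + 1) / 2) - b ^ ((α + 1) / 2)) ^ 2 := by
  have ha : 0 ≤ a := hb.trans hab
  have hd : 0 ≤ a - b := sub_nonneg.2 hab
  calc (a - b) ^ 2 * (a + b) ^ (α - 1)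
      ≤ (a - b) ^ 2 * (2 * a) ^ (α - 1) := by
        gcongr
        · linarith
    _ = 2 ^ (α - 1) * ((a - b) * a ^ ((α + 1) / 2 - 1)) ^ 2 := by
        have hsq : a ^ (α - 1) = (a ^ ((α + 1) / 2 - 1)) ^ 2 := by
          rw [← Real.rpow_mul_natCast ha]
          congr 1
          push_cast
          ring
        rw [Real.mul_rpow zero_le_two ha, hsq]
        ring
    _ ≤ 2 ^ (α - 1) * (a ^ ((α + 1) / 2) - b ^ ((α + 1) / 2)) ^ 2 := by
        gcongr
        exact sub_mul_rpow_sub_one_le (by linarith) hb hab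

/-- For every `α ≥ 1` there is `C > 0` such that for all reals `a, b ≥ 0`,
`(a − b)² (a + b)^{α−1} ≤ C (a^{(α+1)/2} − b^{(α+1)/2})²`. -/
theorem algebraic_inequality_second (α : ℝ) (hα : 1 ≤ α) :
    ∃ C > 0, ∀ a b : ℝ, 0 ≤ a → 0 ≤ b →
      (a - b) ^ 2 * (a + b) ^ (α - 1) ≤ C * (a ^ ((α + 1) / 2) - b ^ ((α + 1) / 2)) ^ 2 := by
  refine ⟨2 ^ (α - 1), by positivity, fun a b ha hb => ?_⟩
  rcases le_total b a with h | h
  · exact sq_sub_mul_rpow_add_le_of_le hα hb h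
  · rw [sub_sq_comm a b, add_comm a b, sub_sq_comm (a ^ ((α + 1) / 2))]
    exact sq_sub_mul_rpow_add_le_of_le hα ha h
end

section
/- Let Ω ⊂ ℝ^N be a bounded open set with C² boundary, and let 0 < s < 1 with s ≠ 1/2 and N ≥ 2s. Then there exists a constant C = C(Ω, N, s) > 0 such that for every measurable φ : ℝ^N → ℝ vanishing almost everywhere on ℝ^N \ Ω and with finite Gagliardo seminorm [φ]_{s,2}, one has ∫_Ω φ(x)² / δ(x)^{2s} dx ≤ C ∬_{ℝ^N×ℝ^N} |φ(x) − φ(y)|² / |x−y|^{N+2s} dx dy. -/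
open MeasureTheory Metric

/-- Near a boundary point, a set with `C²` boundary satisfies a uniform exterior corkscrew
condition. -/
lemma HasC2Boundary.eventually_exists_ball_subset_compl {E : Type*} [NormedAddCommGroup E]
    [NormedSpace ℝ E] {Ω : Set E} (h : HasC2Boundary Ω) {z₀ : E} (hz₀ : z₀ ∈ frontier Ω) :
    ∃ k > 0, ∀ᶠ z in nhdsWithin z₀ (frontier Ω), ∀ t, 0 < t → t ≤ k →
      ∃ p, dist p z ≤ t ∧ ball p (k * t) ⊆ Ωᶜ := by
  obtain ⟨U, hU, hzU, ρ, hρ, hΩU, hfU, hd⟩ := h z₀ hz₀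
  set L := fderiv ℝ ρ z₀ with hL
  have hL0 : L ≠ 0 := hd z₀ ⟨hz₀, hzU⟩
  obtain ⟨e, he1, hLe⟩ : ∃ e : E, ‖e‖ ≤ 1 ∧ 0 < L e := by
    obtain ⟨v, hv⟩ : ∃ v, L v ≠ 0 := by
      by_contra! hcon
      exact hL0 (ContinuousLinearMap.ext hcon)
    obtain ⟨w, hw⟩ : ∃ w, 0 < L w := by
      rcases lt_or_gt_of_ne hv with h1 | h1
      · exact ⟨-v, by simpa using h1⟩
      · exact ⟨v, h1⟩
    have hw0 : 0 < ‖w‖ := norm_pos_iff.2 fun h0 => by simp [h0] at hw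
    refine ⟨‖w‖⁻¹ • w, ?_, ?_⟩
    · rw [norm_smul, norm_inv, norm_norm, inv_mul_cancel₀ hw0.ne']
    · rw [map_smul, smul_eq_mul]; positivity
  set a := L e with ha
  have hstrict : HasStrictFDerivAt ρ L z₀ := hρ.contDiffAt.hasStrictFDerivAt (by norm_num)
  have hε : 0 < a / 4 := by positivity
  have hev := (hstrict.isLittleO.def hε)
  rw [Metric.eventually_nhds_iff] at hev
  obtain ⟨r, hr, hev⟩ := hev
  obtain ⟨r', hr', hrU⟩ := Metric.isOpen_iff.1 hU z₀ hzU
  set R := min r r' with hR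
  have hR0 : 0 < R := lt_min hr hr'
  set k := min (min 1 (R / 4)) (a / (4 * (‖L‖ + 1))) with hk
  have hLn := norm_nonneg L
  have hk0 : 0 < k := by positivity
  have hk1 : k ≤ 1 := (min_le_left _ _).trans (min_le_left _ _)
  have hkR : k ≤ R / 4 := (min_le_left _ _).trans (min_le_right _ _)
  have hkL : ‖L‖ * k ≤ a / 4 := by
    have h1 : k ≤ a / (4 * (‖L‖ + 1)) := min_le_right _ _
    rw [le_div_iff₀ (by positivity)] at h1
    nlinarith
  refine ⟨k, hk0, ?_⟩
  filter_upwards [self_mem_nhdsWithin,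
    mem_nhdsWithin_of_mem_nhds (Metric.ball_mem_nhds z₀ (half_pos hR0))] with z hz hzR t ht htk
  refine ⟨z + t • e, ?_, ?_⟩
  · rw [dist_eq_norm, add_sub_cancel_left, norm_smul, Real.norm_of_nonneg ht.le]
    nlinarith
  intro y hy hyΩ
  rw [mem_ball, dist_eq_norm] at hy hzR
  set w := y - (z + t • e) with hw
  have hyz : y - z = t • e + w := by rw [hw]; abel
  have hte : ‖t • e‖ ≤ t := by
    rw [norm_smul, Real.norm_of_nonneg ht.le]; nlinarith
  have hyzn : ‖y - z‖ ≤ 2 * t := by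
    rw [hyz]
    have := norm_add_le (t • e) w
    nlinarith
  have hyR : ‖y - z₀‖ < R := by
    have := norm_add_le (y - z) (z - z₀)
    rw [sub_add_sub_cancel] at this
    linarith
  have hzR' : ‖z - z₀‖ < R := by linarith
  have hyU : y ∈ U := hrU (by rw [mem_ball, dist_eq_norm]; exact hyR.trans_le (min_le_right _ _))
  have hzU' : z ∈ U := hrU (by rw [mem_ball, dist_eq_norm]; exact hzR'.trans_le (min_le_right _ _))
  have hρz : ρ z = 0 := by
    have : z ∈ frontier Ω ∩ U := ⟨hz, hzU'⟩
    rw [hfU] at this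
    exact this.2
  have hρy : ρ y < 0 := by
    have : y ∈ Ω ∩ U := ⟨hyΩ, hyU⟩
    rw [hΩU] at this
    exact this.2
  have hdist : dist (y, z) (z₀, z₀) < r := by
    rw [Prod.dist_eq, max_lt_iff, dist_eq_norm, dist_eq_norm]
    exact ⟨hyR.trans_le (min_le_left _ _), hzR'.trans_le (min_le_left _ _)⟩
  have hest := hev hdist
  simp only [hρz, sub_zero] at hest
  have hLw : -(‖L‖ * ‖w‖) ≤ L w := by
    have := L.le_opNorm w
    rw [Real.norm_eq_abs] at this
    exact (abs_le.1 this).1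
  have hLyz : L (y - z) = t * a + L w := by
    rw [hyz, map_add, map_smul, smul_eq_mul]
  rw [hLyz, Real.norm_eq_abs] at hest
  have h1 := (abs_le.1 hest).1
  have h2 : ‖L‖ * ‖w‖ ≤ a / 4 * t := by
    calc ‖L‖ * ‖w‖ ≤ ‖L‖ * (k * t) := by gcongr
      _ = ‖L‖ * k * t := by ring
      _ ≤ a / 4 * t := by gcongr
  have h3 : a / 4 * ‖y - z‖ ≤ a / 4 * (2 * t) := by gcongr
  have h4 : 0 < a * t := by positivity
  nlinarith

/-- A set with compact `C²` boundary satisfies a uniform exterior corkscrew condition. -/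
lemma HasC2Boundary.exists_ball_subset_compl {E : Type*} [NormedAddCommGroup E]
    [NormedSpace ℝ E] {Ω : Set E} (h : HasC2Boundary Ω) (hc : IsCompact (frontier Ω)) :
    ∃ k > 0, ∀ z ∈ frontier Ω, ∀ t, 0 < t → t ≤ k →
      ∃ p, dist p z ≤ t ∧ ball p (k * t) ⊆ Ωᶜ := by
  refine hc.induction_on (p := fun S => ∃ k > 0, ∀ z ∈ S, ∀ t, 0 < t → t ≤ k →
      ∃ p, dist p z ≤ t ∧ ball p (k * t) ⊆ Ωᶜ) ⟨1, one_pos, by simp⟩ ?_ ?_ ?_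
  · rintro S T hST ⟨k, hk, hT⟩
    exact ⟨k, hk, fun z hz => hT z (hST hz)⟩
  · rintro S T ⟨k, hk, hS⟩ ⟨l, hl, hT⟩
    refine ⟨min k l, lt_min hk hl, ?_⟩
    rintro z (hz | hz) t ht htk
    · obtain ⟨p, hp, hb⟩ := hS z hz t ht (htk.trans (min_le_left _ _))
      exact ⟨p, hp, (ball_subset_ball (by gcongr; exact min_le_left _ _)).trans hb⟩
    · obtain ⟨p, hp, hb⟩ := hT z hz t ht (htk.trans (min_le_right _ _))
      exact ⟨p, hp, (ball_subset_ball (by gcongr; exact min_le_right _ _)).trans hb⟩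
  · intro z hz
    obtain ⟨k, hk, hev⟩ := h.eventually_exists_ball_subset_compl hz
    exact ⟨_, hev, k, hk, fun z hz => hz⟩

/-- In a bounded set with `C²` boundary, every point sees an exterior ball whose radius and
distance are both comparable to the distance to the boundary. -/
lemma HasC2Boundary.exists_ball_subset_compl_inter_closedBall {E : Type*} [NormedAddCommGroup E]
    [NormedSpace ℝ E] [ProperSpace E] {Ω : Set E} (h : HasC2Boundary Ω)
    (hb : Bornology.IsBounded Ω) :
    ∃ m > 0, ∀ x ∈ Ω, 0 < infDist x (frontier Ω) →
      ∃ p, ball p (m * infDist x (frontier Ω)) ⊆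
        Ωᶜ ∩ closedBall x (3 * infDist x (frontier Ω)) := by
  have hc : IsCompact (frontier Ω) :=
    hb.isCompact_closure.of_isClosed_subset isClosed_frontier frontier_subset_closure
  obtain ⟨k, hk, hball⟩ := h.exists_ball_subset_compl hc
  rcases (frontier Ω).eq_empty_or_nonempty with he | hne
  · exact ⟨1, one_pos, fun x _ hx => by simp [he] at hx⟩
  obtain ⟨z₀, hz₀⟩ := hne
  obtain ⟨D, hD⟩ := hb.subset_closedBall z₀
  set κ := min (min 1 (1 / k)) (k / (|D| + 1)) with hκ
  have hκ0 : 0 < κ := by positivity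
  have hκ1 : κ ≤ 1 := (min_le_left _ _).trans (min_le_left _ _)
  have hκk : k * κ ≤ 1 := by
    have : κ ≤ 1 / k := (min_le_left _ _).trans (min_le_right _ _)
    rwa [le_div_iff₀ hk, mul_comm] at this
  have hκD : κ * (|D| + 1) ≤ k := by
    have : κ ≤ k / (|D| + 1) := min_le_right _ _
    rwa [le_div_iff₀ (by positivity)] at this
  refine ⟨k * κ, by positivity, fun x hx hδ => ?_⟩
  obtain ⟨z, hz, hxz⟩ := isClosed_frontier.exists_infDist_eq_dist ⟨z₀, hz₀⟩ x
  set δ := infDist x (frontier Ω) with hδdef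
  have hδD : δ ≤ |D| + 1 := by
    have h1 : δ ≤ dist x z₀ := infDist_le_dist_of_mem hz₀
    have h2 : dist x z₀ ≤ D := hD hx
    linarith [le_abs_self D]
  obtain ⟨p, hp, hpb⟩ := hball z hz (κ * δ) (by positivity)
    ((mul_le_mul_of_nonneg_left hδD hκ0.le).trans hκD)
  rw [← mul_assoc] at hpb
  refine ⟨p, Set.subset_inter hpb fun y hy => ?_⟩
  rw [mem_ball] at hy
  rw [mem_closedBall]
  have h1 : dist y x ≤ dist y p + dist p z + dist z x := dist_triangle4 _ _ _ _
  rw [dist_comm z x] at h1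
  nlinarith

/-- Pointwise Hardy-type bound: the nonlocal energy density of a function vanishing outside `Ω`
controls its square weighted by the distance to an exterior ball. -/
lemma ofReal_le_lintegral_gagliardo {N : ℕ} {Ω : Set (EuclideanSpace ℝ (Fin N))} {s m δ : ℝ}
    (hs : 0 < s) (hm : 0 < m) (hδ : 0 < δ) {φ : EuclideanSpace ℝ (Fin N) → ℝ}
    (hφ : ∀ᵐ x ∂(volume.restrict Ωᶜ), φ x = 0) {x p : EuclideanSpace ℝ (Fin N)} (hx : x ∈ Ω)
    (hp : ball p (m * δ) ⊆ Ωᶜ ∩ closedBall x (3 * δ)) :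
    ENNReal.ofReal (φ x ^ 2 / δ ^ (2 * s)) ≤
      ENNReal.ofReal (m ^ N * (volume (ball (0 : EuclideanSpace ℝ (Fin N)) 1)).toReal /
        3 ^ ((N : ℝ) + 2 * s))⁻¹ *
      ∫⁻ y, ENNReal.ofReal ((φ x - φ y) ^ 2 / ‖x - y‖ ^ ((N : ℝ) + 2 * s)) := by
  set V := volume (ball (0 : EuclideanSpace ℝ (Fin N)) 1) with hV
  have hVtop : V ≠ ⊤ := measure_ball_lt_top.ne
  have hV0 : 0 < V.toReal := ENNReal.toReal_pos (measure_ball_pos _ _ one_pos).ne' hVtop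
  set c := m ^ N * V.toReal / 3 ^ ((N : ℝ) + 2 * s) with hc
  have hc0 : 0 < c := by positivity
  have hvol : volume (ball p (m * δ)) = ENNReal.ofReal ((m * δ) ^ N * V.toReal) := by
    rw [Measure.addHaar_ball_of_pos _ _ (by positivity), finrank_euclideanSpace_fin,
      ENNReal.ofReal_mul (by positivity), ENNReal.ofReal_toReal hVtop]
  have hkey : ENNReal.ofReal (c * (φ x ^ 2 / δ ^ (2 * s))) ≤
      ∫⁻ y, ENNReal.ofReal ((φ x - φ y) ^ 2 / ‖x - y‖ ^ ((N : ℝ) + 2 * s)) := by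
    calc ENNReal.ofReal (c * (φ x ^ 2 / δ ^ (2 * s)))
        = ENNReal.ofReal (φ x ^ 2 / (3 * δ) ^ ((N : ℝ) + 2 * s)) * volume (ball p (m * δ)) := by
          rw [hvol, ← ENNReal.ofReal_mul (by positivity), hc, Real.mul_rpow (by norm_num) hδ.le,
            Real.rpow_add hδ, Real.rpow_natCast, mul_pow]
          congr 1
          field_simp
      _ = ∫⁻ _ in ball p (m * δ), ENNReal.ofReal (φ x ^ 2 / (3 * δ) ^ ((N : ℝ) + 2 * s)) := by
          rw [setLIntegral_const]
      _ ≤ ∫⁻ y in ball p (m * δ),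
            ENNReal.ofReal ((φ x - φ y) ^ 2 / ‖x - y‖ ^ ((N : ℝ) + 2 * s)) := by
          refine lintegral_mono_ae ?_
          filter_upwards [ae_restrict_mem measurableSet_ball,
            ae_restrict_of_ae_restrict_of_subset (hp.trans Set.inter_subset_left) hφ] with y hy hy0
          obtain ⟨hyΩ, hyx⟩ := hp hy
          have hpos : 0 < ‖x - y‖ := by
            rw [norm_pos_iff, sub_ne_zero]
            rintro rfl
            exact hyΩ hx
          rw [mem_closedBall, dist_comm, dist_eq_norm] at hyx
          rw [hy0, sub_zero]
          gcongr
      _ ≤ _ := setLIntegral_le_lintegral _ _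
  calc ENNReal.ofReal (φ x ^ 2 / δ ^ (2 * s))
      = ENNReal.ofReal c⁻¹ * ENNReal.ofReal (c * (φ x ^ 2 / δ ^ (2 * s))) := by
        rw [← ENNReal.ofReal_mul (by positivity), inv_mul_cancel_left₀ hc0.ne']
    _ ≤ _ := by gcongr

/-- Fractional Hardy inequality: let `Ω ⊂ ℝ^N` be bounded open with `C²`
boundary, `0 < s < 1`, `s ≠ 1/2`, `N ≥ 2s`. Then there is `C = C(Ω,N,s) > 0` such that for
every measurable `φ` vanishing a.e. outside `Ω` with finite Gagliardo seminorm `[φ]_{s,2}`,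
`∫_Ω φ(x)²/δ(x)^{2s} dx ≤ C ∬ |φ(x)−φ(y)|²/|x−y|^{N+2s} dx dy`. -/
theorem fractional_hardy_inequality (N : ℕ)
    (Ω : Set (EuclideanSpace ℝ (Fin N))) (hΩo : IsOpen Ω)
    (hΩb : Bornology.IsBounded Ω) (hC2 : HasC2Boundary Ω)
    (s : ℝ) (hs0 : 0 < s) (hs1 : s < 1) (hs2 : s ≠ 1 / 2) (hNs : 2 * s ≤ N) :
    ∃ C > 0, ∀ φ : EuclideanSpace ℝ (Fin N) → ℝ,
      Measurable φ →
      (∀ᵐ x ∂(volume.restrict Ωᶜ), φ x = 0) →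
      Integrable (fun q : EuclideanSpace ℝ (Fin N) × EuclideanSpace ℝ (Fin N) =>
        (φ q.1 - φ q.2) ^ 2 / ‖q.1 - q.2‖ ^ ((N : ℝ) + 2 * s)) →
      (∫ x in Ω, (φ x) ^ 2 / (infDist x (frontier Ω)) ^ (2 * s))
        ≤ C * ∫ x : EuclideanSpace ℝ (Fin N), ∫ y : EuclideanSpace ℝ (Fin N),
            (φ x - φ y) ^ 2 / ‖x - y‖ ^ ((N : ℝ) + 2 * s) := by
  obtain ⟨m, hm, hball⟩ := hC2.exists_ball_subset_compl_inter_closedBall hΩb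
  set V := volume (ball (0 : EuclideanSpace ℝ (Fin N)) 1) with hV
  have hV0 : 0 < V.toReal :=
    ENNReal.toReal_pos (measure_ball_pos _ _ one_pos).ne' measure_ball_lt_top.ne
  refine ⟨(m ^ N * V.toReal / 3 ^ ((N : ℝ) + 2 * s))⁻¹, by positivity, fun φ hφ hφ0 hint => ?_⟩
  set C := (m ^ N * V.toReal / 3 ^ ((N : ℝ) + 2 * s))⁻¹ with hC
  have hC0 : 0 ≤ C := by positivity
  have hF0 : ∀ q : EuclideanSpace ℝ (Fin N) × EuclideanSpace ℝ (Fin N),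
      0 ≤ (φ q.1 - φ q.2) ^ 2 / ‖q.1 - q.2‖ ^ ((N : ℝ) + 2 * s) := fun q => by positivity
  have hpt : ∀ x ∈ Ω, ENNReal.ofReal (φ x ^ 2 / infDist x (frontier Ω) ^ (2 * s)) ≤
      ENNReal.ofReal C *
        ∫⁻ y, ENNReal.ofReal ((φ x - φ y) ^ 2 / ‖x - y‖ ^ ((N : ℝ) + 2 * s)) := by
    intro x hx
    rcases (infDist_nonneg (x := x) (s := frontier Ω)).eq_or_lt with h0 | hpos
    · rw [← h0, Real.zero_rpow (by positivity), div_zero, ENNReal.ofReal_zero]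
      exact zero_le
    · obtain ⟨p, hp⟩ := hball x hx hpos
      exact ofReal_le_lintegral_gagliardo hs0 hm hpos hφ0 hx hp
  rw [Measure.volume_eq_prod] at hint
  rw [← integral_prod _ hint, integral_eq_lintegral_of_nonneg_ae
    (Filter.Eventually.of_forall fun x => div_nonneg (sq_nonneg _)
      (Real.rpow_nonneg infDist_nonneg _))
    (((hφ.pow_const 2).div
      ((measurable_infDist).pow_const (2 * s))).aestronglyMeasurable)]
  refine ENNReal.toReal_le_of_le_ofReal
    (mul_nonneg hC0 (integral_nonneg hF0)) ?_
  rw [ENNReal.ofReal_mul hC0, ofReal_integral_eq_lintegral_ofReal hint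
    (Filter.Eventually.of_forall hF0), lintegral_prod _ hint.aemeasurable.ennreal_ofReal,
    ← lintegral_const_mul' _ _ ENNReal.ofReal_ne_top]
  exact (setLIntegral_mono' hΩo.measurableSet hpt).trans (setLIntegral_le_lintegral _ _)
end

section
/- Let N ≥ 1, s ∈ (0,1) and 0 < ρ < 1. Then there exists a constant C = C(N, s, ρ) > 0 such that for every t > 0 and all x, y ∈ ℝ^N with x ≠ y, ∫_{ℝ^N} [ t / (t^{1/(2s)} + |z−y|)^{N+2s} ] · |x−z|^{−(N+ρ−1)} dz ≤ C |x−y|^{−(N+ρ−1)}. -/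
open MeasureTheory

/-- An integrable function that is translated and dilated by `c > 0` stays integrable, and its
integral is multiplied by `c ^ N`. -/
lemma integrable_and_integral_comp_inv_smul_sub {N : ℕ} {f : EuclideanSpace ℝ (Fin N) → ℝ}
    (hf : Integrable f) {c : ℝ} (hc : 0 < c) (y : EuclideanSpace ℝ (Fin N)) :
    Integrable (fun z => f (c⁻¹ • (z - y))) ∧
      ∫ z, f (c⁻¹ • (z - y)) = c ^ (N : ℝ) * ∫ w, f w := by
  refine ⟨((integrable_comp_smul_iff volume f (inv_ne_zero hc.ne')).2 hf).comp_sub_right y, ?_⟩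
  rw [integral_sub_right_eq_self (fun z => f (c⁻¹ • z)) y,
    Measure.integral_comp_inv_smul_of_nonneg volume f hc.le]
  simp

/-- The singularity `‖w‖ ^ (-a)` is integrable on the unit ball when `a < N`. -/
lemma integrable_indicator_norm_lt_one_rpow {N : ℕ} (hN : 1 ≤ N) {a : ℝ} (ha : a < N) :
    Integrable (fun w : EuclideanSpace ℝ (Fin N) =>
      (Set.Iio (1 : ℝ)).indicator (fun u => u ^ (-a)) ‖w‖) := by
  have : NeZero N := ⟨by omega⟩
  rw [integrable_fun_norm_addHaar volume (f := (Set.Iio (1 : ℝ)).indicator (fun u => u ^ (-a)))]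
  have h : IntegrableOn (fun u : ℝ => u ^ ((N : ℝ) - 1 - a)) (Set.Ioo 0 1) :=
    (intervalIntegral.integrableOn_Ioo_rpow_iff one_pos).2 (by linarith)
  rw [← integrable_indicator_iff measurableSet_Ioo] at h
  refine h.integrableOn.congr_fun (fun u (hu : 0 < u) => ?_) measurableSet_Ioi
  by_cases hu1 : u < 1
  · simp [hu, hu1, sub_eq_add_neg, Real.rpow_add hu, ← Real.rpow_natCast, Nat.cast_sub hN]
  · simp [hu1]

/-- The scaled profile is a dilation of the unit profile. -/
lemma profile_eq_dilation {N : ℕ} {s t : ℝ} (hs : 0 < s) (ht : 0 < t)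
    (w : EuclideanSpace ℝ (Fin N)) :
    t / (t ^ (1 / (2 * s)) + ‖w‖) ^ ((N : ℝ) + 2 * s) =
      (t ^ (1 / (2 * s))) ^ (-(N : ℝ)) *
        (1 + ‖(t ^ (1 / (2 * s)))⁻¹ • w‖) ^ (-((N : ℝ) + 2 * s)) := by
  have hl : 0 < t ^ (1 / (2 * s)) := by positivity
  have hlt : t = (t ^ (1 / (2 * s))) ^ (2 * s) := by
    rw [← Real.rpow_mul ht.le, one_div_mul_cancel (by positivity), Real.rpow_one]
  set l := t ^ (1 / (2 * s))
  have h1 : l + ‖w‖ = l * (1 + ‖l⁻¹ • w‖) := by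
    rw [norm_smul, norm_inv, Real.norm_of_nonneg hl.le]
    field_simp
  rw [h1, Real.mul_rpow hl.le (by positivity), Real.rpow_neg hl.le,
    Real.rpow_neg (by positivity), Real.rpow_add hl]
  nth_rewrite 1 [hlt]
  field_simp

/-- The scaled profile is at most `r ^ (-N)` outside the ball of radius `r`. -/
lemma profile_le_rpow_neg {N : ℕ} {s t r u : ℝ} (hs : 0 < s) (ht : 0 < t) (hr : 0 < r)
    (hu : r ≤ u) :
    t / (t ^ (1 / (2 * s)) + u) ^ ((N : ℝ) + 2 * s) ≤ r ^ (-(N : ℝ)) := by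
  have hl : 0 < t ^ (1 / (2 * s)) := by positivity
  have hlt : t = (t ^ (1 / (2 * s))) ^ (2 * s) := by
    rw [← Real.rpow_mul ht.le, one_div_mul_cancel (by positivity), Real.rpow_one]
  set l := t ^ (1 / (2 * s))
  have h0 : 0 < l + u := by linarith
  rw [div_le_iff₀ (by positivity), Real.rpow_add h0, Real.rpow_neg hr.le, ← mul_assoc,
    inv_mul_eq_div]
  have h1 : t ≤ (l + u) ^ (2 * s) := by
    rw [hlt]
    exact Real.rpow_le_rpow hl.le (by linarith) (by positivity)
  have h2 : 1 ≤ (l + u) ^ (N : ℝ) / r ^ (N : ℝ) := by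
    rw [one_le_div (by positivity)]
    exact Real.rpow_le_rpow hr.le (by linarith) (by positivity)
  nlinarith

/-- Let `N ≥ 1`, `s ∈ (0,1)` and `0 < ρ < 1`. There is
`C = C(N,s,ρ) > 0` such that for every `t > 0` and all `x ≠ y` in `ℝ^N`,
`∫_{ℝ^N} [t / (t^{1/(2s)} + |z−y|)^{N+2s}] |x−z|^{−(N+ρ−1)} dz ≤ C |x−y|^{−(N+ρ−1)}`. -/
theorem fractional_heat_profile_convolution_estimate (N : ℕ) (hN : 1 ≤ N)
    (s ρ : ℝ) (hs0 : 0 < s) (hs1 : s < 1) (hρ0 : 0 < ρ) (hρ1 : ρ < 1) :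
    ∃ C > 0, ∀ t > 0, ∀ x y : EuclideanSpace ℝ (Fin N), x ≠ y →
      (∫ z : EuclideanSpace ℝ (Fin N),
          (t / (t ^ (1 / (2 * s)) + ‖z - y‖) ^ ((N : ℝ) + 2 * s)) *
            ‖x - z‖ ^ (-((N : ℝ) + ρ - 1)))
        ≤ C * ‖x - y‖ ^ (-((N : ℝ) + ρ - 1)) := by
  have hN' : (1 : ℝ) ≤ N := by exact_mod_cast hN
  obtain ⟨a, ha⟩ : ∃ a, (N : ℝ) + ρ - 1 = a := ⟨_, rfl⟩
  have ha0 : 0 < a := by linarith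
  have haN : a < N := by linarith
  rw [ha]
  let P : EuclideanSpace ℝ (Fin N) → ℝ := fun w => (1 + ‖w‖) ^ (-((N : ℝ) + 2 * s))
  let h : EuclideanSpace ℝ (Fin N) → ℝ := fun w =>
    (Set.Iio (1 : ℝ)).indicator (fun u => u ^ (-a)) ‖w‖
  have hP : Integrable P := integrable_one_add_norm (by simp; linarith)
  have hh : Integrable h := integrable_indicator_norm_lt_one_rpow hN haN
  have hP0 : ∀ w, 0 ≤ P w := fun w => by positivity
  have hh0 : ∀ w, 0 ≤ h w := fun w =>
    Set.indicator_apply_nonneg fun _ => Real.rpow_nonneg (norm_nonneg w) _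
  have hK : 0 ≤ ∫ w, P w := integral_nonneg hP0
  have hc : 0 ≤ ∫ w, h w := integral_nonneg hh0
  refine ⟨2 ^ a * ((∫ w, P w) + (∫ w, h w) + 1), by positivity, fun t ht x y hxy => ?_⟩
  have hl : 0 < t ^ (1 / (2 * s)) := by positivity
  have hR : 0 < ‖x - y‖ := norm_pos_iff.2 (sub_ne_zero.2 hxy)
  obtain ⟨r, hr⟩ : ∃ r, ‖x - y‖ / 2 = r := ⟨_, rfl⟩
  have hr0 : 0 < r := by linarith
  obtain ⟨hPi, hPe⟩ := integrable_and_integral_comp_inv_smul_sub hP hl y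
  obtain ⟨hhi, hhe⟩ := integrable_and_integral_comp_inv_smul_sub hh hr0 x
  have hra : 2 ^ a * ‖x - y‖ ^ (-a) = r ^ (-a) := by
    rw [← hr, Real.div_rpow hR.le (by norm_num), Real.rpow_neg (by norm_num : (0 : ℝ) ≤ 2)]
    field_simp
  have hint : (∫ z, (r ^ (-a) * (t ^ (1 / (2 * s))) ^ (-(N : ℝ)) *
        P ((t ^ (1 / (2 * s)))⁻¹ • (z - y)) +
      r ^ (-a) * r ^ (-(N : ℝ)) * h (r⁻¹ • (z - x)))) =
      r ^ (-a) * ((∫ w, P w) + ∫ w, h w) := by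
    rw [integral_add (hPi.const_mul _) (hhi.const_mul _), integral_const_mul, integral_const_mul,
      hPe, hhe, Real.rpow_neg hl.le, Real.rpow_neg hr0.le (N : ℝ)]
    field_simp
  calc _ ≤ ∫ z, (r ^ (-a) * (t ^ (1 / (2 * s))) ^ (-(N : ℝ)) *
        P ((t ^ (1 / (2 * s)))⁻¹ • (z - y)) +
      r ^ (-a) * r ^ (-(N : ℝ)) * h (r⁻¹ • (z - x))) := by
        refine integral_mono_of_nonneg (.of_forall fun z => by positivity)
          ((hPi.const_mul _).add (hhi.const_mul _)) (.of_forall fun z => ?_)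
        dsimp only
        rcases le_or_gt r ‖x - z‖ with hz | hz
        · have h1 : ‖x - z‖ ^ (-a) ≤ r ^ (-a) :=
            Real.rpow_le_rpow_of_nonpos hr0 hz (by linarith)
          rw [profile_eq_dilation hs0 ht, mul_assoc (r ^ (-a)), mul_comm (r ^ (-a))]
          have h2 := hh0 (r⁻¹ • (z - x))
          refine le_add_of_le_of_nonneg ?_ (by positivity)
          gcongr
        · have h1 : r ≤ ‖z - y‖ := by
            have := norm_sub_le_norm_sub_add_norm_sub x z y
            linarith
          have h2 : r ^ (-a) * h (r⁻¹ • (z - x)) = ‖x - z‖ ^ (-a) := by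
            have hn : ‖r⁻¹ • (z - x)‖ = ‖x - z‖ / r := by
              rw [norm_smul, norm_inv, Real.norm_of_nonneg hr0.le, norm_sub_rev, inv_mul_eq_div]
            simp only [h]
            rw [hn, Set.indicator_of_mem (Set.mem_Iio.2 ((div_lt_one hr0).2 hz)),
              ← Real.mul_rpow hr0.le (by positivity), mul_div_cancel₀ _ hr0.ne']
          have h3 := hP0 ((t ^ (1 / (2 * s)))⁻¹ • (z - y))
          refine le_add_of_nonneg_of_le (by positivity) ?_
          rw [mul_right_comm, h2, mul_comm (‖x - z‖ ^ (-a))]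
          gcongr
          exact profile_le_rpow_neg hs0 ht hr0 h1
    _ = r ^ (-a) * ((∫ w, P w) + ∫ w, h w) := hint
    _ ≤ r ^ (-a) * ((∫ w, P w) + (∫ w, h w) + 1) := by
        exact mul_le_mul_of_nonneg_left (by linarith) (by positivity)
    _ = _ := by rw [← hra]; ring
end
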